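/- arXiv:1407.7007 — 4 statements merged into one kernel-verified Lean document; each statement's English description precedes it below -/
import Mathlib

section
/- Let A = {d_1, …, d_n} be a set of positive integers with n ≥ 4 such that {d_1, …, d_{n−1}} is a generalized arithmetic sequence, gcd(d_1, …, d_n) = 1, and such that {d_n, d_2, …, d_{n−1}} is not an arithmetic sequence. Then the projective toric ideal I_{A*} is a complete intersection if and only if n = 4, {d_1, d_2, d_3} is an arithmetic sequence, and one of the following holds: (1) d_1/gcd(d_1, d_2) is even and there exist β_1, β_2, β_3 ∈ ℕ with gcd(d_1, d_2)·d_4 = β_1 d_1 + β_2 d_2 + β_3 d_3 and β_1 + β_2 + β_3 ≤ gcd(d_1, d_2); or (2) d_1 and d_4 are both even and the projective toric ideal I_{C*} of the three-element set C = {d_1, d_3, d_4} is a complete intersection (i.e., I_{C*} can be generated by 2 elements). -/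
open MvPolynomial

/-- The `(p,q)`-Fibonacci sequence: `F 0 = 0`, `F 1 = 1`, `F (n+2) = p * F (n+1) + q * F n`. -/
def pqFib (p q : ℕ) : ℕ → ℕ
  | 0 => 0
  | 1 => 1
  | n + 2 => p * pqFib p q (n + 1) + q * pqFib p q n

/-- The `(p,q)`-Lucas sequence: `L 0 = 2`, `L 1 = p`, `L (n+2) = p * L (n+1) + q * L n`. -/
def pqLucas (p q : ℕ) : ℕ → ℕ
  | 0 => 2
  | 1 => p
  | n + 2 => p * pqLucas p q (n + 1) + q * pqLucas p q n

/-- The toric ideal of the affine monomial curve `t ↦ (t^{d 0}, …, t^{d (n-1)})`: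
the kernel of the `k`-algebra map `k[x_1,…,x_n] → k[t]`, `x_i ↦ t^{d i}`. -/
noncomputable def toricIdeal (k : Type*) [Field k] {n : ℕ} (d : Fin n → ℕ) :
    Ideal (MvPolynomial (Fin n) k) :=
  RingHom.ker (MvPolynomial.aeval
    (fun i : Fin n => (Polynomial.X : Polynomial k) ^ d i)).toRingHom

/-- The toric ideal `I_A` is a complete intersection iff it can be generated by
`n - 1` elements. -/
def IsCI (k : Type*) [Field k] {n : ℕ} (d : Fin n → ℕ) : Prop :=
  ∃ g : Fin (n - 1) → MvPolynomial (Fin n) k,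
    Ideal.span (Set.range g) = toricIdeal k d

/-- The toric ideal of the projective monomial curve: the kernel of the `k`-algebra map
`k[x_1,…,x_{n+1}] → k[t,u]`, `x_i ↦ t^{d i} u^{D - d i}` for `i ≤ n` and
`x_{n+1} ↦ u^D`, where `D = max A`. -/
noncomputable def projToricIdeal (k : Type*) [Field k] {n : ℕ} (d : Fin n → ℕ) :
    Ideal (MvPolynomial (Fin (n + 1)) k) :=
  RingHom.ker (MvPolynomial.aeval (fun i : Fin (n + 1) =>
    if h : (i : ℕ) < n then
      (X 0 : MvPolynomial (Fin 2) k) ^ d ⟨i, h⟩ *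
        (X 1 : MvPolynomial (Fin 2) k) ^ (Finset.univ.sup d - d ⟨i, h⟩)
    else (X 1 : MvPolynomial (Fin 2) k) ^ (Finset.univ.sup d))).toRingHom

/-- The projective toric ideal `I_{A*}` is a complete intersection iff it can be
generated by `n - 1` elements. -/
def ProjIsCI (k : Type*) [Field k] {n : ℕ} (d : Fin n → ℕ) : Prop :=
  ∃ g : Fin (n - 1) → MvPolynomial (Fin (n + 1)) k,
    Ideal.span (Set.range g) = projToricIdeal k d

/-- `d 0 < d 1 < ⋯` is a generalized arithmetic sequence: there are positive
integers `h, e` with `d i = h * d 0 + i * e` for every `i ≥ 1`. -/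
def IsGenArith {n : ℕ} (d : Fin n → ℕ) : Prop :=
  ∃ h e : ℕ, 0 < h ∧ 0 < e ∧
    ∀ i : Fin n, 0 < (i : ℕ) → d i = h * d ⟨0, i.pos⟩ + (i : ℕ) * e

/-- `d 0 < d 1 < ⋯` is an increasing arithmetic sequence: there is a positive
integer `e` with `d i = d 0 + i * e` for every `i`. -/
def IsArithFn {n : ℕ} (d : Fin n → ℕ) : Prop :=
  ∃ e : ℕ, 0 < e ∧ ∀ i : Fin n, 0 < (i : ℕ) → d i = d ⟨0, i.pos⟩ + (i : ℕ) * e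

/-- `A = {d 0, …, d (n-1)}` minimally generates the numerical semigroup
`ℕ d 0 + ⋯ + ℕ d (n-1)`: no `d i` lies in the subsemigroup generated by the rest. -/
def MinimallyGenerates {n : ℕ} (d : Fin n → ℕ) : Prop :=
  ∀ i : Fin n, ¬ ∃ α : Fin n → ℕ, α i = 0 ∧ d i = ∑ j, α j * d j



section alg
attribute [local instance] MvPolynomial.gradedAlgebra
variable {ι κ : Type*} [Fintype ι]

def MRel (P : ι → ℕ) (a b : ι → ℕ) : Prop :=
  ∑ i, a i = ∑ i, b i ∧ ∑ i, a i * P i = ∑ i, b i * P i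

def Clo (R : κ → (ι → ℕ) × (ι → ℕ)) (T : Set (ι → ℕ)) : Prop :=
  ∀ j m, (R j).1 + m ∈ T ↔ (R j).2 + m ∈ T

def Gens (P : ι → ℕ) (R : κ → (ι → ℕ) × (ι → ℕ)) : Prop :=
  (∀ j, MRel P (R j).1 (R j).2) ∧ ∀ T, Clo R T → ∀ a b, MRel P a b → (a ∈ T ↔ b ∈ T)

variable (k : Type*) [Field k]

noncomputable def mon (a : ι → ℕ) : MvPolynomial ι k :=
  monomial (Finsupp.equivFunOnFinite.symm a) 1

lemma mon_add (a b : ι → ℕ) : mon k (a + b) = mon k a * mon k b := by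
  unfold mon
  rw [monomial_mul, one_mul]
  congr 2
  ext; simp

lemma mon_hom (a : ι → ℕ) : (mon k a).IsHomogeneous (∑ i, a i) := by
  apply isHomogeneous_monomial
  rw [Finsupp.degree_eq_sum]
  rfl

lemma mon_coe (a : ι →₀ ℕ) (c : k) : monomial a c = c • mon k (a : ι → ℕ) := by
  unfold mon
  rw [smul_monomial, smul_eq_mul, mul_one]
  congr 1
  ext; simp

noncomputable def bin (p : (ι → ℕ) × (ι → ℕ)) : MvPolynomial ι k := mon k p.1 - mon k p.2

lemma ker_le (φ : MvPolynomial ι k →ₐ[k] MvPolynomial (Fin 2) k)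
    (π : (ι → ℕ) → (Fin 2 →₀ ℕ)) (hφ : ∀ a, φ (mon k a) = monomial (π a) 1)
    (J : Ideal (MvPolynomial ι k)) (hJ : ∀ a b, π a = π b → mon k a - mon k b ∈ J) 
    (f : MvPolynomial ι k) (hf : φ f = 0) : f ∈ J := by
  classical
  let ψ : MvPolynomial (Fin 2) k →ₗ[k] MvPolynomial ι k :=
    (basisMonomials (Fin 2) k).constr k
      (fun b => if h : ∃ a, π a = b then mon k h.choose else 0)
  have key : ∀ f, f - ψ (φ f) ∈ J := by
    intro f
    induction f using MvPolynomial.induction_on' with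
    | monomial a c =>
      rw [mon_coe, map_smul, map_smul, ← smul_sub, hφ]
      have : ψ (monomial (π a) 1) =
          if h : ∃ a', π a' = π a then mon k h.choose else 0 := by
        have := (basisMonomials (Fin 2) k).constr_basis k
          (fun b => if h : ∃ a, π a = b then mon k h.choose else 0) (π a)
        rw [← this]
        simp only [ψ, coe_basisMonomials]
      rw [this]
      have hex : ∃ a', π a' = π a := ⟨_, rfl⟩
      rw [dif_pos hex, Algebra.smul_def]
      exact J.mul_mem_left _ (hJ _ _ hex.choose_spec.symm)
    | add p q hp hq =>
      have := J.add_mem hp hq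
      simp only [map_add]
      convert this using 1
      ring
  simpa [hf] using key f

lemma gens_span {P : ι → ℕ} (φ : MvPolynomial ι k →ₐ[k] MvPolynomial (Fin 2) k)
    (π : (ι → ℕ) → (Fin 2 →₀ ℕ)) (hφ : ∀ a, φ (mon k a) = monomial (π a) 1)
    (hπ : ∀ a b, π a = π b ↔ MRel P a b) {R : κ → (ι → ℕ) × (ι → ℕ)} (hR : Gens P R) :
    Ideal.span (Set.range fun j => bin k (R j)) = RingHom.ker φ.toRingHom := by
  apply le_antisymm
  · rw [Ideal.span_le]
    rintro _ ⟨j, rfl⟩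
    have := (hπ _ _).2 (hR.1 j)
    simp [bin, RingHom.mem_ker, hφ, this]
  · intro f hf
    refine ker_le k φ π hφ _ ?_ f hf
    intro a b hab
    have := hR.2 {c | mon k c - mon k b ∈ Ideal.span (Set.range fun j => bin k (R j))} ?_ a b
      ((hπ _ _).1 hab)
    · simpa using this
    · intro j m
      have h1 : bin k (R j) * mon k m ∈ Ideal.span (Set.range fun j => bin k (R j)) :=
        Ideal.mul_mem_right _ _ (Ideal.subset_span ⟨j, rfl⟩)
      simp only [Set.mem_ofPred_eq]
      have e : mon k ((R j).1 + m) - mon k b = (mon k ((R j).2 + m) - mon k b)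
          + bin k (R j) * mon k m := by
        simp [mon_add, bin]; ring
      rw [e]
      exact Ideal.add_mem_iff_left _ h1

lemma mk_span (𝔪 : Ideal (MvPolynomial ι k)) (h𝔪 : ∀ r, r - C (constantCoeff r) ∈ 𝔪)
    (I : Ideal (MvPolynomial ι k)) (G : Set (MvPolynomial ι k)) (hG : Ideal.span G = I)
    (x : MvPolynomial ι k) (hx : x ∈ I) :
    Ideal.Quotient.mkₐ k (𝔪 * I) x ∈ Submodule.span k (Ideal.Quotient.mkₐ k (𝔪 * I) '' G) := by
  subst hG
  induction hx using Submodule.span_induction with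
  | mem x h => exact Submodule.subset_span ⟨x, h, rfl⟩
  | zero => simp
  | add x y _ _ h1 h2 => rw [map_add]; exact Submodule.add_mem _ h1 h2
  | smul r x hx h =>
    have : Ideal.Quotient.mkₐ k (𝔪 * Ideal.span G) (r • x) =
        (constantCoeff r) • Ideal.Quotient.mkₐ k (𝔪 * Ideal.span G) x := by
      rw [← map_smul, Ideal.Quotient.mkₐ_eq_mk, Ideal.Quotient.eq]
      have := Ideal.mul_mem_mul (h𝔪 r) (show x ∈ Ideal.span G from hx)
      convert this using 1
      rw [smul_eq_mul, Algebra.smul_def, sub_mul]; rfl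
    rw [this]
    exact Submodule.smul_mem _ _ h

lemma coeff_one_mul (r f : MvPolynomial ι k) (s : ℕ) (hf : f.IsHomogeneous s)
    (hr : constantCoeff r = 1) : homogeneousComponent s (r * f) = f := by
  classical
  have h0 : homogeneousComponent s ((r - 1) * f) = 0 := by
    ext d
    rw [coeff_homogeneousComponent]
    split_ifs with hd
    · rw [coeff_mul, coeff_zero]
      apply Finset.sum_eq_zero
      rintro ⟨u, v⟩ huv
      rw [Finset.HasAntidiagonal.mem_antidiagonal] at huv
      by_cases hv : coeff v f = 0
      · simp [hv]
      · have hv' : v.degree = s := by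
          by_contra h
          exact hv (hf.coeff_eq_zero h)
        have : u = 0 := by
          rw [← Finsupp.degree_eq_zero_iff]
          have := congrArg Finsupp.degree huv
          simp only [map_add] at this
          omega
        subst this
        have : coeff 0 (r - 1) = 0 := by
          rw [← constantCoeff_eq]; simp [hr]
        simp only
        rw [this, zero_mul]
    · simp
  have e : r * f = (r - 1) * f + f := by ring
  rw [e, map_add, h0, zero_add]
  exact homogeneousComponent_eq_self hf

lemma span_gens {P : ι → ℕ} (φ : MvPolynomial ι k →ₐ[k] MvPolynomial (Fin 2) k)
    (π : (ι → ℕ) → (Fin 2 →₀ ℕ)) (hφ : ∀ a, φ (mon k a) = monomial (π a) 1)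
    (hπ : ∀ a b, π a = π b ↔ MRel P a b) (m : ℕ) (g : Fin m → MvPolynomial ι k)
    (hg : Ideal.span (Set.range g) = RingHom.ker φ.toRingHom) :
    ∃ R : Fin m → (ι → ℕ) × (ι → ℕ), Gens P R := by
  classical
  set I := RingHom.ker φ.toRingHom with hI
  set 𝔪 : Ideal (MvPolynomial ι k) := RingHom.ker constantCoeff with hm
  have h𝔪 : ∀ r : MvPolynomial ι k, r - C (constantCoeff r) ∈ 𝔪 := by
    intro r; simp [hm, RingHom.mem_ker]
  set B : Set (MvPolynomial ι k) := {f | ∃ p : (ι → ℕ) × (ι → ℕ), MRel P p.1 p.2 ∧ bin k p = f}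
  have hBI : ∀ p : (ι → ℕ) × (ι → ℕ), MRel P p.1 p.2 → bin k p ∈ I := by
    intro p hp
    have := (hπ _ _).2 hp
    simp [hI, bin, RingHom.mem_ker, hφ, this]
  have hB : Ideal.span B = I := by
    apply le_antisymm
    · rw [Ideal.span_le]
      rintro _ ⟨p, hp, rfl⟩
      exact hBI p hp
    · intro f hf
      refine ker_le k φ π hφ _ ?_ f hf
      intro a b hab
      exact Ideal.subset_span ⟨(a, b), (hπ _ _).1 hab, rfl⟩
  set mk := Ideal.Quotient.mkₐ k (𝔪 * I) with hmk
  have hle : Submodule.span k (mk '' B) ≤ Submodule.span k (Set.range (mk ∘ g)) := by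
    rw [Submodule.span_le]
    rintro _ ⟨f, hf, rfl⟩
    have := mk_span k 𝔪 h𝔪 I _ hg f (hB ▸ Ideal.subset_span hf)
    rwa [← Set.range_comp] at this
  have : Module.Finite k (Submodule.span k (Set.range (mk ∘ g))) :=
    Module.Finite.span_of_finite k (Set.finite_range _)
  have : Module.Finite k (Submodule.span k (mk '' B)) := Submodule.finiteDimensional_of_le hle
  have hrank : Module.finrank k (Submodule.span k (mk '' B)) ≤ m := by
    refine (Submodule.finrank_mono hle).trans ?_
    have := finrank_range_le_card (R := k) (mk ∘ g)
    simpa [Set.finrank] using this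
  obtain ⟨f, hf, hfs, -⟩ := Submodule.exists_fun_fin_finrank_span_eq k (mk '' B)
  have hf' : ∀ i, ∃ p : (ι → ℕ) × (ι → ℕ), MRel P p.1 p.2 ∧ mk (bin k p) = f i := by
    intro i
    obtain ⟨x, ⟨p, hp, rfl⟩, hx⟩ := hf i
    exact ⟨p, hp, hx⟩
  choose p hp hpf using hf'
  let R : Fin m → (ι → ℕ) × (ι → ℕ) := fun i =>
    if h : (i : ℕ) < Module.finrank k (Submodule.span k (mk '' B)) then p ⟨i, h⟩ else (0, 0)
  have hRrel : ∀ j, MRel P (R j).1 (R j).2 := by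
    intro j
    simp only [R]
    split_ifs
    · exact hp _
    · exact ⟨rfl, rfl⟩
  have hRp : ∀ i, ∃ j, R j = p i := by
    intro i
    refine ⟨⟨i, by omega⟩, ?_⟩
    simp [R]
  set J := Ideal.span (Set.range fun j => bin k (R j)) with hJ
  have hIJ : I ≤ J ⊔ 𝔪 • I := by
    intro x hx
    have h1 := mk_span k 𝔪 h𝔪 I _ hB x hx
    rw [← hmk, ← hfs] at h1
    have h2 : Submodule.span k (Set.range f) ≤ (J.restrictScalars k).map mk.toLinearMap := by
      rw [Submodule.span_le]
      rintro _ ⟨i, rfl⟩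
      obtain ⟨j, hj⟩ := hRp i
      refine ⟨bin k (R j), Ideal.subset_span ⟨j, rfl⟩, ?_⟩
      rw [hj]; exact hpf i
    obtain ⟨y, hy, hyx⟩ := h2 h1
    have h3 : x - y ∈ 𝔪 * I := by
      rw [← Ideal.Quotient.eq]
      exact hyx.symm
    have : x = y + (x - y) := by ring
    rw [this]
    exact Submodule.add_mem_sup hy h3
  have hfg : I.FG := by
    rw [← hg]; exact ⟨Finset.univ.image g, by simp⟩
  obtain ⟨r, hr1, hr2⟩ := Submodule.exists_sub_one_mem_and_smul_le_of_fg_of_le_sup hfg le_rfl hIJ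
  have hr : constantCoeff r = 1 := by
    rw [hm, RingHom.mem_ker, map_sub, map_one, sub_eq_zero] at hr1
    exact hr1
  have hJhom : J.IsHomogeneous (homogeneousSubmodule ι k) := by
    apply Ideal.homogeneous_span
    rintro _ ⟨j, rfl⟩
    refine ⟨∑ i, (R j).1 i, ?_⟩
    refine (mon_hom k _).sub ?_
    rw [(hRrel j).1]
    exact mon_hom k _
  have hbinJ : ∀ p : (ι → ℕ) × (ι → ℕ), MRel P p.1 p.2 → bin k p ∈ J := by
    intro p hp
    have h1 : r * bin k p ∈ J := hr2 (Submodule.smul_mem_pointwise_smul _ _ _ (hBI p hp))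
    have h2 : (bin k p).IsHomogeneous (∑ i, p.1 i) := by
      refine (mon_hom k _).sub ?_
      rw [hp.1]
      exact mon_hom k _
    have h3 := homogeneousComponent_mem_of_mem hJhom h1 (∑ i, p.1 i)
    rwa [coeff_one_mul k r _ _ h2 hr] at h3
  refine ⟨R, hRrel, ?_⟩
  intro T hT a b hab
  let lam : MvPolynomial ι k →ₗ[k] k :=
    (basisMonomials ι k).constr k (fun a => if (a : ι → ℕ) ∈ T then 1 else 0)
  have hlam : ∀ a, lam (mon k a) = if a ∈ T then 1 else 0 := by
    intro a
    have := (basisMonomials ι k).constr_basis k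
      (fun a => if (a : ι → ℕ) ∈ T then (1 : k) else 0) (Finsupp.equivFunOnFinite.symm a)
    rw [coe_basisMonomials] at this
    refine Eq.trans ?_ (this.trans ?_)
    · rfl
    · by_cases h : a ∈ T <;> simp [h]
  have hker : ∀ x ∈ J, lam x = 0 := by
    intro x hx
    have : ∀ s : MvPolynomial ι k, ∀ j, lam (s * bin k (R j)) = 0 := by
      intro s j
      induction s using MvPolynomial.induction_on' with
      | monomial a c =>
        rw [mon_coe, smul_mul_assoc, map_smul, bin, mul_sub, ← mon_add, ← mon_add, map_sub,
          hlam, hlam]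
        have := hT j a
        rw [add_comm] at this
        rw [add_comm _ (a : ι → ℕ)] at this
        simp [this]
      | add p q hp hq => rw [add_mul, map_add, hp, hq, add_zero]
    induction hx using Submodule.span_induction with
    | mem x h => obtain ⟨j, rfl⟩ := h; simpa using this 1 j
    | zero => simp
    | add x y _ _ h1 h2 => rw [map_add, h1, h2, add_zero]
    | smul s x hx h =>
      clear h
      induction hx using Submodule.span_induction generalizing s with
      | mem x h => obtain ⟨j, rfl⟩ := h; exact this s j
      | zero => simp
      | add x y _ _ h1 h2 => rw [smul_add, map_add, h1, h2, add_zero]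
      | smul s' x hx h => rw [← mul_smul]; exact h _
  have h1 := hker _ (hbinJ (a, b) hab)
  simp only [bin, map_sub, hlam] at h1
  by_cases ha : a ∈ T <;> by_cases hb : b ∈ T <;> simp_all

end alg


section bridge

def extz {n : ℕ} (d : Fin n → ℕ) : Fin (n + 1) → ℕ :=
  fun i => if h : (i : ℕ) < n then d ⟨i, h⟩ else 0

lemma projCI_iff (k : Type*) [Field k] {n : ℕ} (d : Fin n → ℕ) (hD : 0 < Finset.univ.sup d) :
    ProjIsCI k d ↔ ∃ R : Fin (n - 1) → (Fin (n + 1) → ℕ) × (Fin (n + 1) → ℕ),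
      Gens (extz d) R := by
  classical
  set D := Finset.univ.sup d with hDdef
  have hle : ∀ i, extz d i ≤ D := by
    intro i
    unfold extz
    split_ifs
    · exact Finset.le_sup (f := d) (Finset.mem_univ _)
    · exact Nat.zero_le _
  let q : Fin (n + 1) → (Fin 2 →₀ ℕ) := fun i =>
    Finsupp.single 0 (extz d i) + Finsupp.single 1 (D - extz d i)
  let π : (Fin (n + 1) → ℕ) → (Fin 2 →₀ ℕ) := fun a => ∑ i, a i • q i
  let F : Fin (n + 1) → MvPolynomial (Fin 2) k := fun i =>
    if h : (i : ℕ) < n then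
      (X 0 : MvPolynomial (Fin 2) k) ^ d ⟨i, h⟩ *
        (X 1 : MvPolynomial (Fin 2) k) ^ (Finset.univ.sup d - d ⟨i, h⟩)
    else (X 1 : MvPolynomial (Fin 2) k) ^ (Finset.univ.sup d)
  have hF : ∀ i, F i = monomial (q i) 1 := by
    intro i
    simp only [F, q, extz]
    split_ifs with h
    · rw [X_pow_eq_monomial, X_pow_eq_monomial, monomial_mul, one_mul]
    · rw [X_pow_eq_monomial]; simp [hDdef]
  let φ : MvPolynomial (Fin (n + 1)) k →ₐ[k] MvPolynomial (Fin 2) k := aeval F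
  have hφ : ∀ a, φ (mon k a) = monomial (π a) 1 := by
    intro a
    simp only [φ, mon, aeval_monomial, map_one, one_mul, π]
    rw [Finsupp.prod_fintype _ _ (by simp), monomial_sum_one]
    apply Finset.prod_congr rfl
    intro i _
    rw [hF, monomial_pow, one_pow]; rfl
  have hπ : ∀ a b, π a = π b ↔ MRel (extz d) a b := by
    intro a b
    have e0 : ∀ a : Fin (n + 1) → ℕ, π a 0 = ∑ i, a i * extz d i := by
      intro a; simp [π, q, Finsupp.finset_sum_apply]
    have e1 : ∀ a : Fin (n + 1) → ℕ, π a 1 + ∑ i, a i * extz d i = (∑ i, a i) * D := by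
      intro a
      simp only [π, q, Finsupp.finset_sum_apply, Finset.sum_mul]
      rw [← Finset.sum_add_distrib]
      apply Finset.sum_congr rfl
      intro i _
      simp
      rw [← mul_add, Nat.sub_add_cancel (hle i)]
    have ha := e1 a
    have hb := e1 b
    constructor
    · intro h
      have h0 := e0 a
      rw [h, e0 b] at h0
      refine ⟨?_, h0.symm⟩
      rw [h] at ha
      rw [h0] at hb
      exact Nat.eq_of_mul_eq_mul_right hD (ha.symm.trans hb)
    · rintro ⟨h1, h2⟩
      rw [h1, h2] at ha
      ext i
      fin_cases i
      · show π a 0 = π b 0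
        rw [e0, e0, h2]
      · show π a 1 = π b 1
        omega
  have hker : projToricIdeal k d = RingHom.ker φ.toRingHom := rfl
  constructor
  · rintro ⟨g, hg⟩
    rw [hker] at hg
    exact span_gens k φ π hφ hπ _ g hg
  · rintro ⟨R, hR⟩
    exact ⟨_, gens_span k φ π hφ hπ hR⟩

end bridge


section key
set_option linter.unusedSectionVars false
set_option linter.unusedSimpArgs false
variable {ι κ : Type*} [Fintype ι] [DecidableEq ι]

structure KD (P : ι → ℕ) (u hi : ι) (c : ι → ℕ) (M : ι → ι → ℕ) : Prop where
  two : ∀ i, i ≠ u → i ≠ hi → 2 ≤ c i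
  zero : ∀ i, i ≠ u → i ≠ hi → M i i = 0
  rel : ∀ i, i ≠ u → i ≠ hi → MRel P (Pi.single i (c i)) (M i)
  min : ∀ i, i ≠ u → i ≠ hi → ∀ c' b, c' < c i → MRel P (Pi.single i c') b → b = Pi.single i c'
  clo : ∀ T : Set (ι → ℕ), (∀ i, i ≠ u → i ≠ hi → ∀ m, Pi.single i (c i) + m ∈ T ↔ M i + m ∈ T) →
    ∀ a b, MRel P a b → (a ∈ T ↔ b ∈ T)

lemma MRel.symm {P : ι → ℕ} {a b : ι → ℕ} (h : MRel P a b) : MRel P b a := ⟨h.1.symm, h.2.symm⟩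

lemma MRel.trans {P : ι → ℕ} {a b c : ι → ℕ} (h : MRel P a b) (h' : MRel P b c) : MRel P a c :=
  ⟨h.1.trans h'.1, h.2.trans h'.2⟩

lemma MRel.add_right {P : ι → ℕ} {a b : ι → ℕ} (h : MRel P a b) (m : ι → ℕ) :
    MRel P (a + m) (b + m) := by
  obtain ⟨h1, h2⟩ := h
  constructor
  · simp only [Pi.add_apply, Finset.sum_add_distrib, h1]
  · simp only [Pi.add_apply, add_mul, Finset.sum_add_distrib, h2]

lemma MRel.cancel {P : ι → ℕ} {a b : ι → ℕ} {m : ι → ℕ} (h : MRel P (a + m) (b + m)) :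
    MRel P a b := by
  obtain ⟨h1, h2⟩ := h
  simp only [Pi.add_apply, add_mul, Finset.sum_add_distrib] at h1 h2
  exact ⟨by omega, by omega⟩

lemma single_rel_inj {P : ι → ℕ} (hP : Function.Injective P) {i j : ι} {s t : ℕ} (hs : 0 < s)
    (h : MRel P (Pi.single i s) (Pi.single j t)) : i = j := by
  obtain ⟨h1, h2⟩ := h
  have e1 : ∀ (i : ι) (s : ℕ), ∑ j, (Pi.single i s : ι → ℕ) j = s := by
    intro i s; simp
  have e2 : ∀ (i : ι) (s : ℕ), ∑ j, (Pi.single i s : ι → ℕ) j * P j = s * P i := by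
    intro i s
    simp [Pi.single_apply, ite_mul]
  rw [e1, e1] at h1
  rw [e2, e2] at h2
  subst h1
  exact hP (Nat.eq_of_mul_eq_mul_left hs h2)

lemma le_single {i : ι} {a m : ι → ℕ} {s : ℕ} (h : a + m = Pi.single i s) :
    a = Pi.single i (a i) ∧ m = Pi.single i (m i) ∧ a i + m i = s := by
  refine ⟨?_, ?_, ?_⟩
  · ext j
    by_cases hj : j = i
    · subst hj; simp
    · have := congrFun h j
      simp [hj] at this ⊢
      exact this.1
  · ext j
    by_cases hj : j = i
    · subst hj; simp
    · have := congrFun h j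
      simp [hj] at this ⊢
      exact this.2
  · have := congrFun h i
    simpa using this

theorem key [Fintype κ] {P : ι → ℕ} {R : κ → (ι → ℕ) × (ι → ℕ)} (hR : Gens P R)
    (hcard : Fintype.card κ + 2 ≤ Fintype.card ι) (hP : Function.Injective P) (u hi : ι)
    (hu : P u = 0) (hhi : ∀ i, P i ≤ P hi) (huhi : u ≠ hi) :
    ∃ c M, KD P u hi c M := by
  classical
  have hex : ∀ i, i ≠ u → i ≠ hi → ∃ c, ∃ b, MRel P (Pi.single i c) b ∧ b ≠ Pi.single i c := by
    intro i hiu hih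
    refine ⟨P hi, Pi.single hi (P i) + Pi.single u (P hi - P i), ⟨?_, ?_⟩, ?_⟩
    · simp only [Pi.add_apply, Finset.sum_add_distrib]
      have := hhi i
      simp; omega
    · simp only [Pi.add_apply, Finset.sum_add_distrib, add_mul]
      simp [Pi.single_apply, ite_mul, hu, mul_comm]
    · intro h
      have := congrFun h i
      simp [Pi.single_apply, hiu, hih] at this
      have h1 := hhi u
      have h2 : P hi = P u := by omega
      exact huhi (hP h2.symm)
  let c : ι → ℕ := fun i => if h : i ≠ u ∧ i ≠ hi then Nat.find (hex i h.1 h.2) else 0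
  have hmin : ∀ i, i ≠ u → i ≠ hi → ∀ c' b, c' < c i → MRel P (Pi.single i c') b →
      b = Pi.single i c' := by
    intro i h1 h2 c' b hc hb
    simp only [c, dif_pos (show i ≠ u ∧ i ≠ hi from ⟨h1, h2⟩)] at hc
    by_contra hne
    exact Nat.find_min (hex i h1 h2) hc ⟨b, hb, hne⟩
  have hsp : ∀ i, i ≠ u → i ≠ hi → ∃ b, MRel P (Pi.single i (c i)) b ∧ b ≠ Pi.single i (c i) := by
    intro i h1 h2
    simp only [c, dif_pos (show i ≠ u ∧ i ≠ hi from ⟨h1, h2⟩)]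
    exact Nat.find_spec (hex i h1 h2)
  have htwo : ∀ i, i ≠ u → i ≠ hi → 2 ≤ c i := by
    intro i h1 h2
    obtain ⟨b, hb, hne⟩ := hsp i h1 h2
    by_contra hlt
    have hs : c i = ∑ i, b i := by
      have := hb.1
      simpa using this
    by_cases h0 : c i = 0
    · apply hne
      rw [h0] at hs ⊢
      have := Finset.sum_eq_zero_iff.1 hs.symm
      ext j
      simpa using this j (Finset.mem_univ _)
    · have h1' : c i = 1 := by omega
      rw [h1'] at hs
      have : ∃ j, b j ≠ 0 := by
        by_contra hh
        push Not at hh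
        simp [hh] at hs
      obtain ⟨j, hj⟩ := this
      have hsplit := Finset.add_sum_erase Finset.univ b (Finset.mem_univ j)
      have hbj : b = Pi.single j 1 := by
        have hz : ∑ x ∈ Finset.univ.erase j, b x = 0 := by omega
        have hz' := Finset.sum_eq_zero_iff.1 hz
        ext x
        by_cases hx : x = j
        · subst hx; simp; omega
        · simpa [hx] using hz' x (by simp [hx])
      rw [hbj, h1'] at hb
      have := single_rel_inj hP Nat.one_pos hb
      exact hne (by rw [h1', hbj, this])
  have hR1 := hR.1
  have hj : ∀ i, i ≠ u → i ≠ hi → ∃ j M, (R j = (Pi.single i (c i), M) ∨ R j = (M, Pi.single i (c i)))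
      ∧ M ≠ Pi.single i (c i) := by
    intro i h1 h2
    obtain ⟨b, hb, hne⟩ := hsp i h1 h2
    have hT : ¬ Clo R {Pi.single i (c i)} := by
      intro hcl
      have := hR.2 _ hcl _ _ hb
      simp at this
      exact hne this
    unfold Clo at hT
    push Not at hT
    obtain ⟨j, m, hjm⟩ := hT
    have hh : ∀ A B : ι → ℕ, MRel P A B → A + m = Pi.single i (c i) → B + m ≠ Pi.single i (c i) →
        A = Pi.single i (c i) ∧ B ≠ Pi.single i (c i) := by
      intro A B hAB hA hB
      obtain ⟨e1, e2, e3⟩ := le_single hA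
      by_cases hlt : A i < c i
      · exfalso
        have := hmin i h1 h2 (A i) B hlt (e1 ▸ hAB)
        apply hB
        rw [this, ← e1, hA]
      · have h4 : A i = c i := by omega
        have hm0 : m i = 0 := by omega
        rw [hm0] at e2
        rw [h4] at e1
        refine ⟨e1, ?_⟩
        intro hB'
        apply hB
        rw [hB', e2]; simp
    simp only [Set.mem_singleton_iff] at hjm
    rcases hjm with ⟨hA, hB⟩ | ⟨hB, hA⟩
    · obtain ⟨q1, q2⟩ := hh _ _ (hR1 j) hA hB
      exact ⟨j, (R j).2, Or.inl (Prod.ext q1 rfl), q2⟩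
    · obtain ⟨q1, q2⟩ := hh _ _ (hR1 j).symm hA hB
      exact ⟨j, (R j).1, Or.inr (Prod.ext rfl q1), q2⟩
  rcases isEmpty_or_nonempty κ with he | he
  · exact ⟨c, fun _ _ => 0, htwo, fun _ _ _ => rfl, fun i h1 h2 => he.elim (hj i h1 h2).choose,
      hmin, fun T _ a b hab => hR.2 T (fun j => he.elim j) a b hab⟩
  choose! jj M hjM hMne using hj
  have hrel : ∀ i, i ≠ u → i ≠ hi → MRel P (Pi.single i (c i)) (M i) := by
    intro i h1 h2
    have := hR1 (jj i)
    rcases hjM i h1 h2 with h | h <;> rw [h] at this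
    · exact this
    · exact this.symm
  have hinj : Set.InjOn jj (((Finset.univ.erase u).erase hi : Finset ι) : Set ι) := by
    intro i hi' i' hi'' heq
    simp only [Finset.coe_erase, Finset.coe_univ, Set.mem_sdiff, Set.mem_univ, true_and,
      Set.mem_singleton_iff] at hi' hi''
    have hc := htwo i hi'.1 hi'.2
    have r1 := hrel i hi'.1 hi'.2
    rcases hjM i hi'.1 hi'.2 with h | h <;> rcases hjM i' hi''.1 hi''.2 with h' | h' <;>
      rw [heq, h'] at h <;> obtain ⟨q1, q2⟩ := Prod.ext_iff.1 h <;> simp only at q1 q2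
    · exact single_rel_inj hP (by omega : 0 < c i) (show MRel P _ (Pi.single i' (c i')) by
        rw [q1]; exact ⟨rfl, rfl⟩)
    · exact single_rel_inj hP (by omega : 0 < c i) (show MRel P _ (Pi.single i' (c i')) by
        rw [q2]; exact r1)
    · exact single_rel_inj hP (by omega : 0 < c i) (show MRel P _ (Pi.single i' (c i')) by
        rw [q1]; exact r1)
    · exact single_rel_inj hP (by omega : 0 < c i) (show MRel P _ (Pi.single i' (c i')) by
        rw [q2]; exact ⟨rfl, rfl⟩)
  have hsurj : ∀ j, ∃ i, (i ≠ u ∧ i ≠ hi) ∧ jj i = j := by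
    have h1 : ((Finset.univ.erase u).erase hi).image jj = Finset.univ := by
      apply Finset.eq_univ_of_card
      apply le_antisymm (Finset.card_le_univ _)
      rw [Finset.card_image_of_injOn hinj, Finset.card_erase_of_mem (by simp [huhi.symm]),
        Finset.card_erase_of_mem (by simp), Finset.card_univ]
      omega
    intro j
    have := Finset.mem_univ j
    rw [← h1] at this
    simp only [Finset.mem_image, Finset.mem_erase, Finset.mem_univ, and_true] at this
    obtain ⟨i, h2, h3⟩ := this
    exact ⟨i, ⟨h2.2, h2.1⟩, h3⟩
  refine ⟨c, M, htwo, ?_, hrel, hmin, ?_⟩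
  · intro i h1 h2
    by_contra h0
    have hc := htwo i h1 h2
    have r := hrel i h1 h2
    have e1 : (Pi.single i (c i) : ι → ℕ) = Pi.single i (c i - 1) + Pi.single i 1 := by
      rw [← Pi.single_add]; congr; omega
    have e2 : M i = (fun j => if j = i then M i i - 1 else M i j) + Pi.single i 1 := by
      ext j
      by_cases hj : j = i
      · subst hj; simp; omega
      · simp [hj]
    rw [e1, e2] at r
    have := hmin i h1 h2 (c i - 1) _ (by omega) r.cancel
    rw [this, ← e1] at e2
    exact hMne i h1 h2 e2
  · intro T hT a b hab
    refine hR.2 T ?_ a b hab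
    intro j m
    obtain ⟨i, ⟨h1, h2⟩, rfl⟩ := hsurj j
    have := hT i h1 h2 m
    rcases hjM i h1 h2 with h | h <;> rw [h]
    · exact this
    · exact this.symm

namespace KD
variable {P : ι → ℕ} {u hi : ι} {c : ι → ℕ} {M : ι → ι → ℕ}

lemma esc (K : KD P u hi c M) (T : Set (ι → ℕ)) {a b : ι → ℕ} (hab : MRel P a b) (ha : a ∈ T)
    (hb : b ∉ T) : ∃ i m, i ≠ u ∧ i ≠ hi ∧ ((Pi.single i (c i) + m ∈ T ∧ M i + m ∉ T) ∨
      (M i + m ∈ T ∧ Pi.single i (c i) + m ∉ T)) := by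
  by_contra hcon
  push Not at hcon
  apply hb
  refine (K.clo T ?_ a b hab).1 ha
  intro i h1 h2 m
  obtain ⟨q1, q2⟩ := hcon i m h1 h2
  exact ⟨q1, q2⟩

lemma move (K : KD P u hi c M) {a b : ι → ℕ} (hab : MRel P a b) (hne : a ≠ b) :
    ∃ i, i ≠ u ∧ i ≠ hi ∧ (c i ≤ a i ∨ ∀ j, M i j ≤ a j) := by
  obtain ⟨i, m, h1, h2, h⟩ := K.esc {a} hab rfl (by simpa using hne.symm)
  refine ⟨i, h1, h2, ?_⟩
  simp only [Set.mem_singleton_iff] at h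
  rcases h with ⟨h, -⟩ | ⟨h, -⟩
  · left; rw [← h]; simp
  · right; intro j; rw [← h]; simp

end KD

/-- collapsing a duplicated point -/
theorem collapse {ι' : Type*} [Fintype ι'] [DecidableEq ι'] [Fintype κ] {P : ι → ℕ}
    {R : κ → (ι → ℕ) × (ι → ℕ)} (hR : Gens P R) (P' : ι' → ℕ) (hP' : Function.Injective P')
    (f : ι → ι') (s : ι' → ι) (hfs : ∀ i, f (s i) = i) (hPf : ∀ i, P i = P' (f i))
    (i₀ j₀ : ι) (hij : i₀ ≠ j₀) (hf : f i₀ = f j₀) :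
    ∃ j₁ : κ, ∃ R' : {j : κ // j ≠ j₁} → (ι' → ℕ) × (ι' → ℕ), Gens P' R' := by
  classical
  let push : (ι → ℕ) → (ι' → ℕ) := fun a i' => ∑ i, if f i = i' then a i else 0
  have padd : ∀ a b, push (a + b) = push a + push b := by
    intro a b; ext i'
    simp only [push, Pi.add_apply, ← Finset.sum_add_distrib]
    apply Finset.sum_congr rfl
    intro i _; split_ifs <;> simp
  have psum : ∀ a (Q : ι' → ℕ), ∑ i', push a i' * Q i' = ∑ i, a i * Q (f i) := by
    intro a Q
    simp only [push, Finset.sum_mul]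
    rw [Finset.sum_comm]
    apply Finset.sum_congr rfl
    intro i _
    simp [ite_mul]
  have prel : ∀ a b, MRel P a b → MRel P' (push a) (push b) := by
    rintro a b ⟨h1, h2⟩
    constructor
    · have e1 := psum a (fun _ => 1)
      have e2 := psum b (fun _ => 1)
      simp only [mul_one] at e1 e2
      rw [e1, e2, h1]
    · rw [psum, psum]
      simp only [← hPf]; exact h2
  let lift : (ι' → ℕ) → (ι → ℕ) := fun b i => if s (f i) = i then b (f i) else 0
  have sinj : Function.Injective s := Function.LeftInverse.injective hfs
  have pl : ∀ b, push (lift b) = b := by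
    intro b; ext i'
    simp only [push, lift]
    rw [Finset.sum_eq_single (s i')]
    · simp [hfs]
    · intro i _ hne
      split_ifs with h1 h2
      · exfalso; apply hne; rw [← h2, h1]
      · rfl
      · rfl
    · simp
  have lsum : ∀ b (Q : ι' → ℕ), ∑ i, lift b i * Q (f i) = ∑ i', b i' * Q i' := by
    intro b Q
    rw [← psum, pl]
  have lrel : ∀ a b, MRel P' a b → MRel P (lift a) (lift b) := by
    rintro a b ⟨h1, h2⟩
    constructor
    · have e1 := lsum a (fun _ => 1)
      have e2 := lsum b (fun _ => 1)
      simp only [mul_one] at e1 e2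
      rw [e1, e2, h1]
    · simp only [hPf]
      rw [lsum, lsum, h2]
  have hdeg : ∀ j, (∑ i, (R j).1 i = 1) → push (R j).1 = push (R j).2 := by
    intro j hj
    have hr := prel _ _ (hR.1 j)
    have one : ∀ a : ι' → ℕ, ∑ i, a i = 1 → ∃ i, a = Pi.single i 1 := by
      intro a ha
      have : ∃ j, a j ≠ 0 := by
        by_contra hh
        push Not at hh
        simp [hh] at ha
      obtain ⟨j, hj⟩ := this
      have hsplit := Finset.add_sum_erase Finset.univ a (Finset.mem_univ j)
      have hz : ∑ x ∈ Finset.univ.erase j, a x = 0 := by omega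
      have hz' := Finset.sum_eq_zero_iff.1 hz
      refine ⟨j, ?_⟩
      ext x
      by_cases hx : x = j
      · subst hx; simp; omega
      · simpa [hx] using hz' x (by simp [hx])
    have e1 := psum (R j).1 (fun _ => 1)
    simp only [mul_one] at e1
    obtain ⟨i1, h1⟩ := one (push (R j).1) (e1.trans hj)
    obtain ⟨i2, h2⟩ := one (push (R j).2) (hr.1 ▸ (e1.trans hj))
    rw [h1, h2] at hr ⊢
    rw [single_rel_inj hP' Nat.one_pos hr]
  have hex : ∃ j₁, push (R j₁).1 = push (R j₁).2 := by
    have hT : ¬ Clo R {Pi.single i₀ 1} := by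
      intro hcl
      have := hR.2 _ hcl (Pi.single i₀ 1) (Pi.single j₀ 1) ⟨by simp, by
        simp [Pi.single_apply, ite_mul, hPf, hf]⟩
      simp only [Set.mem_singleton_iff, true_iff] at this
      have := congrFun this i₀
      simp [hij] at this
    unfold Clo at hT
    push Not at hT
    obtain ⟨j, m, hjm⟩ := hT
    refine ⟨j, ?_⟩
    have hcase : ∀ A B : ι → ℕ, MRel P A B → A + m = Pi.single i₀ 1 → B + m ≠ Pi.single i₀ 1 →
        ∑ i, A i = 1 := by
      intro A B hAB h1 h2
      obtain ⟨e1, e2, e3⟩ := le_single h1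
      by_cases h0 : A i₀ = 0
      · exfalso
        rw [h0, Pi.single_zero] at e1
        have := hAB.1
        rw [e1] at this
        simp only [Pi.zero_apply, Finset.sum_const_zero] at this
        have := Finset.sum_eq_zero_iff.1 this.symm
        apply h2
        rw [← h1, e1]
        congr 1
        ext i; simpa using this i (Finset.mem_univ _)
      · rw [e1]; simp; omega
    simp only [Set.mem_singleton_iff] at hjm
    rcases hjm with ⟨hA, hB⟩ | ⟨hB, hA⟩
    · exact hdeg j (hcase _ _ (hR.1 j) hA hB)
    · have := hcase _ _ (hR.1 j).symm hA hB
      exact hdeg j ((hR.1 j).1.trans this)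
  obtain ⟨j₁, hj₁⟩ := hex
  refine ⟨j₁, fun j => (push (R j).1, push (R j).2), fun j => prel _ _ (hR.1 j), ?_⟩
  intro T hT a b hab
  have := hR.2 {x | push x ∈ T} ?_ _ _ (lrel a b hab)
  · simpa [pl] using this
  · intro j m
    simp only [Set.mem_ofPred_eq, padd]
    by_cases h : j = j₁
    · rw [h, hj₁]
    · exact hT ⟨j, h⟩ (push m)

end key

section cases1
set_option linter.unusedSectionVars false
set_option linter.unusedSimpArgs false
variable {ι κ : Type*} [Fintype ι] [DecidableEq ι]

namespace KD
variable {P : ι → ℕ} {u hi : ι} {c : ι → ℕ} {M : ι → ι → ℕ}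

lemma pair (K : KD P u hi c M) {p s : ι} (hps : p ≠ s) {b : ι → ℕ}
    (hb : MRel P (Pi.single p 1 + Pi.single s 1) b) (hne : Pi.single p 1 + Pi.single s 1 ≠ b) :
    ∃ i, i ≠ u ∧ i ≠ hi ∧ c i = 2 ∧ M i = Pi.single p 1 + Pi.single s 1 ∧ 2 * P i = P p + P s := by
  obtain ⟨i, h1, h2, h⟩ := K.move hb hne
  have h3 := K.two i h1 h2
  have h4 := K.rel i h1 h2
  have e1 : ∑ j, (Pi.single p 1 + Pi.single s 1 : ι → ℕ) j = 2 := by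
    simp [Finset.sum_add_distrib]
  rcases h with h | h
  · exfalso
    have : (Pi.single p 1 + Pi.single s 1 : ι → ℕ) i ≤ 1 := by
      simp only [Pi.add_apply, Pi.single_apply]
      split_ifs with q1 q2
      · exact absurd (q1.symm.trans q2) hps
      all_goals omega
    omega
  · have h5 : c i = ∑ j, M i j := by simpa using h4.1
    have h6 : ∑ j, M i j ≤ ∑ j, (Pi.single p 1 + Pi.single s 1 : ι → ℕ) j :=
      Finset.sum_le_sum fun j _ => h j
    have h7 : ∑ j, M i j = ∑ j, (Pi.single p 1 + Pi.single s 1 : ι → ℕ) j := by omega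
    have h8 : M i = Pi.single p 1 + Pi.single s 1 := by
      ext j
      exact (Finset.sum_eq_sum_iff_of_le (fun j _ => h j)).1 h7 j (Finset.mem_univ _)
    refine ⟨i, h1, h2, by omega, h8, ?_⟩
    have h9 := h4.2
    rw [h8] at h9
    have hc : c i = 2 := by omega
    simpa [Pi.single_apply, ite_mul, add_mul, Finset.sum_add_distrib, hc] using h9

lemma quad (K : KD P u hi c M) (hP : Function.Injective P) {p q r s : ι} (hps : p ≠ s)
    (hqr : q ≠ r) (hpq : p ≠ q) (hpr : p ≠ r) (h : P p + P s = P q + P r) : False := by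
  have hne : (Pi.single p 1 + Pi.single s 1 : ι → ℕ) ≠ Pi.single q 1 + Pi.single r 1 := by
    intro h
    have := congrFun h p
    simp [hps, hpq, hpr] at this
  have hrel : MRel P (Pi.single p 1 + Pi.single s 1) (Pi.single q 1 + Pi.single r 1) := by
    constructor
    · simp [Finset.sum_add_distrib]
    · simpa [Pi.single_apply, ite_mul, add_mul, Finset.sum_add_distrib] using h
  obtain ⟨i, -, -, -, h1, h2⟩ := K.pair hps hrel hne
  obtain ⟨j, -, -, -, h3, h4⟩ := K.pair hqr hrel.symm hne.symm
  have : i = j := hP (by omega)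
  subst this
  exact hne (h1.symm.trans h3)

lemma mid (K : KD P u hi c M) (hP : Function.Injective P) {p j s : ι} (hps : p ≠ s)
    (hpj : p ≠ j) (h : 2 * P j = P p + P s) :
    c j = 2 ∧ M j = Pi.single p 1 + Pi.single s 1 := by
  have hne : (Pi.single p 1 + Pi.single s 1 : ι → ℕ) ≠ Pi.single j 2 := by
    intro h
    have := congrFun h p
    simp [hps, hpj] at this
  have hrel : MRel P (Pi.single p 1 + Pi.single s 1) (Pi.single j 2) := by
    constructor
    · simp [Finset.sum_add_distrib]
    · simp [Pi.single_apply, ite_mul, add_mul, Finset.sum_add_distrib, ← h]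
  obtain ⟨i, -, -, h0, h1, h2⟩ := K.pair hps hrel hne
  have : i = j := hP (by omega)
  subst this
  exact ⟨h0, h1⟩

lemma degM (K : KD P u hi c M) (i : ι) (h1 : i ≠ u) (h2 : i ≠ hi) : c i = ∑ j, M i j := by
  simpa using (K.rel i h1 h2).1

lemma valM (K : KD P u hi c M) (i : ι) (h1 : i ≠ u) (h2 : i ≠ hi) :
    c i * P i = ∑ j, M i j * P j := by
  simpa [Pi.single_apply, ite_mul] using (K.rel i h1 h2).2

/-- escape from a set cut out inside a fibre -/
lemma escQ (K : KD P u hi c M) (Q : (ι → ℕ) → Prop) {a b : ι → ℕ} (hab : MRel P a b) (ha : Q a)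
    (hb : ¬ Q b) : ∃ i m, i ≠ u ∧ i ≠ hi ∧ c i + ∑ j, m j = ∑ j, a j ∧
      c i * P i + ∑ j, m j * P j = ∑ j, a j * P j ∧
      ((Q (Pi.single i (c i) + m) ∧ ¬ Q (M i + m)) ∨
      (Q (M i + m) ∧ ¬ Q (Pi.single i (c i) + m))) := by
  obtain ⟨i, m, h1, h2, h⟩ := K.esc {x | MRel P x a ∧ Q x} hab ⟨⟨rfl, rfl⟩, ha⟩ (fun h => hb h.2)
  have r := (K.rel i h1 h2).add_right m
  have key : MRel P (Pi.single i (c i) + m) a := by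
    rcases h with ⟨h, -⟩ | ⟨h, -⟩
    · exact h.1
    · exact r.trans h.1
  refine ⟨i, m, h1, h2, ?_, ?_, ?_⟩
  · simpa [Finset.sum_add_distrib] using key.1
  · simpa [Pi.single_apply, ite_mul, add_mul, Finset.sum_add_distrib] using key.2
  · rcases h with ⟨h, h'⟩ | ⟨h, h'⟩
    · exact Or.inl ⟨h.2, fun hh => h' ⟨r.symm.trans key, hh⟩⟩
    · exact Or.inr ⟨h.2, fun hh => h' ⟨key, hh⟩⟩

end KD
end cases1

section cases2
set_option linter.unusedSimpArgs false

lemma fin5 (i : Fin 5) : i = 0 ∨ i = 1 ∨ i = 2 ∨ i = 3 ∨ i = 4 := by revert i; decide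
lemma fin4 (i : Fin 4) : i = 0 ∨ i = 1 ∨ i = 2 ∨ i = 3 := by revert i; decide
lemma fin6 (i : Fin 6) : i = 0 ∨ i = 1 ∨ i = 2 ∨ i = 3 ∨ i = 4 ∨ i = 5 := by revert i; decide

lemma case4h {P : Fin 5 → ℕ} {hi : Fin 5} {c : Fin 5 → ℕ} {M : Fin 5 → Fin 5 → ℕ}
    (K : KD P 4 hi c M) (hP : Function.Injective P) (hhi : ∀ i, P i ≤ P hi)
    (d h e : ℕ) (hd : 0 < d) (hh : 2 ≤ h) (he : 0 < e)
    (h0 : P 0 = d) (h1 : P 1 = h * d + e) (h2 : P 2 = h * d + 2 * e) (h4 : P 4 = 0)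
    (h3 : P 3 ≠ h * d) : False := by
  obtain ⟨H, hH⟩ : ∃ H, H = h * d := ⟨_, rfl⟩
  have hH2 : 2 * d ≤ H := by rw [hH]; exact Nat.mul_le_mul_right _ hh
  rw [← hH] at h1 h2 h3
  have hinj : ∀ i j, i ≠ j → P i ≠ P j := fun i j hij h => hij (hP h)
  have h31 := hinj 3 1 (by decide)
  have h32 := hinj 3 2 (by decide)
  have h34 := hinj 3 4 (by decide)
  have h30 := hinj 3 0 (by decide)
  have hhi' : (hi = 2 ∧ P 3 < P 2) ∨ (hi = 3 ∧ P 2 < P 3) := by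
    have a1 := hhi 2
    have a2 := hhi 3
    rcases fin5 hi with rfl | rfl | rfl | rfl | rfl
    · omega
    · omega
    · left; exact ⟨rfl, by omega⟩
    · right; exact ⟨rfl, by omega⟩
    · omega
  have n1 : (1 : Fin 5) ≠ hi := by rcases hhi' with ⟨rfl, _⟩ | ⟨rfl, _⟩ <;> decide
  have n0 : (0 : Fin 5) ≠ hi := by rcases hhi' with ⟨rfl, _⟩ | ⟨rfl, _⟩ <;> decide
  have d1 := K.degM 1 (by decide) n1
  have v1 := K.valM 1 (by decide) n1
  have z1 := K.zero 1 (by decide) n1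
  have d0 := K.degM 0 (by decide) n0
  have v0 := K.valM 0 (by decide) n0
  simp only [Fin.sum_univ_five, h0, h1, h2, h4, z1, zero_mul, mul_zero, zero_add, add_zero] at d1 v1 d0 v0
  have t0 := K.two 0 (by decide) n0
  have t1 := K.two 1 (by decide) n1
  -- if c 1 = 2
  have hc1 : c 1 = 2 → M 1 2 = 0 ∧ P 2 < P 3 := by
    intro hc
    rw [hc] at d1 v1
    have b0 : M 1 0 ≤ 2 := by omega
    have b2 : M 1 2 ≤ 2 := by omega
    have b3 : M 1 3 ≤ 2 := by omega
    generalize M 1 0 = p at *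
    generalize M 1 2 = q at *
    generalize M 1 3 = r at *
    generalize M 1 4 = s at *
    interval_cases p <;> interval_cases q <;> interval_cases r <;> omega
  have hmove : (c 1 = 2) ∨ (hi = 2 ∧ 1 ≤ M 3 1 ∧ M 3 0 = 0 ∧ M 3 2 = 0) := by
    have hr : MRel P ![0, 2, 0, 0, h - 1] ![h, 0, 1, 0, 0] := by
      constructor
      · simp [Fin.sum_univ_five]; omega
      · simp [Fin.sum_univ_five, h0, h1, h2, h4]; omega
    obtain ⟨i, q1, q2, q⟩ := K.move hr (by
      intro hne
      have := congrFun hne 1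
      simp at this)
    have ti := K.two i q1 q2
    rcases q with q | q
    · rcases fin5 i with rfl | rfl | rfl | rfl | rfl <;> simp at q q1
      · omega
      · left; omega
      · omega
      · omega
    · have di := K.degM i q1 q2
      have vi := K.valM i q1 q2
      have zi := K.zero i q1 q2
      have r0 := q 0
      have r1 := q 1
      have r2 := q 2
      have r3 := q 3
      have r4 := q 4
      simp at r0 r1 r2 r3 r4
      simp only [Fin.sum_univ_five, h0, h1, h2, h4, r0, r2, r3, zero_mul, mul_zero, zero_add, add_zero] at di vi
      have hpos : 0 < P i → 1 ≤ M i 1 := by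
        intro hp
        by_contra hcon
        have : M i 1 = 0 := by omega
        rw [this, zero_mul] at vi
        have := Nat.mul_pos (by omega : 0 < c i) hp
        omega
      rcases fin5 i with rfl | rfl | rfl | rfl | rfl
      · exfalso
        have hp := hpos (by omega)
        have : c 0 * P 0 ≤ (M 0 1 + (h - 1)) * P 0 := Nat.mul_le_mul_right _ (by omega)
        rw [add_mul, Nat.sub_mul, h0, ← hH] at this
        rw [h0] at vi
        generalize M 0 1 = α at *
        interval_cases α <;> omega
      · exfalso
        have hp := hpos (by omega)
        omega
      · exfalso
        have hp := hpos (by omega)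
        have : M 2 1 * P 2 ≤ c 2 * P 2 := Nat.mul_le_mul_right _ (by omega)
        rw [vi, h2] at this
        have := Nat.le_of_mul_le_mul_left this (by omega)
        omega
      · right
        rcases hhi' with ⟨rfl, _⟩ | ⟨rfl, _⟩
        · exact ⟨rfl, hpos (by omega), r0, r2⟩
        · exact absurd rfl q2
      · exact absurd rfl q1
  have hr : MRel P ![h, 0, 1, 0, 0] ![0, 2, 0, 0, h - 1] := by
    constructor
    · simp [Fin.sum_univ_five]; omega
    · simp [Fin.sum_univ_five, h0, h1, h2, h4]; omega
  obtain ⟨i, m, q1, q2, sd, sv, q⟩ := K.escQ (fun a => a 2 = 1 ∧ a 1 = 0) hr (by simp) (by simp)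
  have ti := K.two i q1 q2
  simp [Fin.sum_univ_five, h0, h1, h2, h4, ← hH] at sd sv
  rcases fin5 i with rfl | rfl | rfl | rfl | rfl
  · simp at q
    rw [h0] at sv
    rcases q with ⟨⟨qa, qb⟩, qc⟩ | ⟨⟨qa, qb, qc⟩, qd⟩
    · have : c 0 * d ≤ h * d := Nat.mul_le_mul_right _ (by omega)
      rw [← hH] at this
      have a1 : M 0 1 = 0 := by
        by_contra hcon
        have := Nat.mul_le_mul_right (H + e) (by omega : 1 ≤ M 0 1)
        omega
      have a2 : M 0 2 = 0 := by
        by_contra hcon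
        have := Nat.mul_le_mul_right (H + 2 * e) (by omega : 1 ≤ M 0 2)
        omega
      omega
    · have a2 : M 0 2 = 1 := by omega
      rw [a2] at v0
      have : h < c 0 := by
        by_contra hcon
        have : c 0 * d ≤ h * d := Nat.mul_le_mul_right _ (by omega)
        omega
      have a3 : c 0 = h + 1 := by omega
      have m0 : m 0 = 0 := by omega
      have m1 : m 1 = 0 := by omega
      have m2 : m 2 = 0 := by omega
      have m3 : m 3 = 0 := by omega
      rw [a3, m0, m1, m2, m3, add_mul, ← hH] at sv
      omega
  · simp at q
    rw [h1] at sv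
    rcases q with ⟨⟨qa, qb⟩, qc⟩ | ⟨⟨qa, qb, qc⟩, qd⟩
    · omega
    · by_cases hm : m 2 = 1
      · rw [hm] at sv
        have := Nat.mul_le_mul_right (H + e) (by omega : 2 ≤ c 1)
        omega
      · by_cases hc : c 1 = 2
        · have := hc1 hc
          omega
        · have := Nat.mul_le_mul_right (H + e) (by omega : 3 ≤ c 1)
          omega
  · simp at q
    rw [h2] at sv
    have := Nat.mul_le_mul_right (H + 2 * e) ti
    omega
  · simp at q
    have hm : hi = 2 ∧ 1 ≤ M 3 1 ∧ M 3 0 = 0 ∧ M 3 2 = 0 := by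
      rcases hmove with h | h
      · exfalso
        have := hc1 h
        rcases hhi' with ⟨rfl, _⟩ | ⟨rfl, _⟩
        · omega
        · exact q2 rfl
      · exact h
    have v3 := K.valM 3 q1 q2
    simp only [Fin.sum_univ_five, h0, h1, h2, h4, hm.2.2, K.zero 3 q1 q2, zero_mul, mul_zero, zero_add, add_zero] at v3
    have := Nat.mul_le_mul_right (H + e) hm.2.1
    rcases q with ⟨⟨qa, qb⟩, qc⟩ | ⟨⟨qa, qb, qc⟩, qd⟩
    · rw [qa] at sv; omega
    · omega
  · exact q1 rfl

end cases2

section cases3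
set_option linter.unusedSimpArgs false

lemma case5h {P : Fin 6 → ℕ} {hi : Fin 6} {c : Fin 6 → ℕ} {M : Fin 6 → Fin 6 → ℕ}
    (K : KD P 5 hi c M) (hP : Function.Injective P) (hhi : ∀ i, P i ≤ P hi)
    (d h e : ℕ) (hd : 0 < d) (hh : 2 ≤ h) (he : 0 < e)
    (h0 : P 0 = d) (h1 : P 1 = h * d + e) (h2 : P 2 = h * d + 2 * e) (h3 : P 3 = h * d + 3 * e)
    (h5 : P 5 = 0) : False := by
  obtain ⟨H, hH⟩ : ∃ H, H = h * d := ⟨_, rfl⟩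
  have hH2 : 2 * d ≤ H := by rw [hH]; exact Nat.mul_le_mul_right _ hh
  rw [← hH] at h1 h2 h3
  have hinj : ∀ i j, i ≠ j → P i ≠ P j := fun i j hij h => hij (hP h)
  have h43 := hinj 4 3 (by decide)
  have h45 := hinj 4 5 (by decide)
  have hhi' : (hi = 3 ∧ P 4 < P 3) ∨ (hi = 4 ∧ P 3 < P 4) := by
    have a1 := hhi 3
    have a2 := hhi 4
    rcases fin6 hi with rfl | rfl | rfl | rfl | rfl | rfl
    · omega
    · omega
    · omega
    · left; exact ⟨rfl, by omega⟩
    · right; exact ⟨rfl, by omega⟩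
    · omega
  have n1 : (1 : Fin 6) ≠ hi := by rcases hhi' with ⟨rfl, _⟩ | ⟨rfl, _⟩ <;> decide
  have n0 : (0 : Fin 6) ≠ hi := by rcases hhi' with ⟨rfl, _⟩ | ⟨rfl, _⟩ <;> decide
  have d0 := K.degM 0 (by decide) n0
  have v0 := K.valM 0 (by decide) n0
  simp only [Fin.sum_univ_six, h0, h1, h2, h3, h5, zero_mul, mul_zero, zero_add, add_zero] at d0 v0
  have t0 := K.two 0 (by decide) n0
  have t1 := K.two 1 (by decide) n1
  obtain ⟨c2, M2⟩ := K.mid hP (p := 1) (j := 2) (s := 3) (by decide) (by decide) (by omega)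
  have M21 : M 2 1 = 1 := by rw [M2]; simp
  have M23 : M 2 3 = 1 := by rw [M2]; simp
  have hmove : hi = 3 ∧ M 4 0 = 0 ∧ M 4 1 ≤ 1 ∧ M 4 2 ≤ 1 ∧ M 4 3 = 0 ∧ 1 ≤ M 4 1 + M 4 2 := by
    have hr : MRel P ![0, 1, 1, 0, 0, h - 1] ![h, 0, 0, 1, 0, 0] := by
      constructor
      · simp [Fin.sum_univ_six]; omega
      · simp [Fin.sum_univ_six, h0, h1, h2, h3, h5]; omega
    obtain ⟨i, q1, q2, q⟩ := K.move hr (by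
      intro hne
      have := congrFun hne 1
      simp at this)
    have ti := K.two i q1 q2
    rcases q with q | q
    · rcases fin6 i with rfl | rfl | rfl | rfl | rfl | rfl <;> simp at q q1 <;> omega
    · have di := K.degM i q1 q2
      have vi := K.valM i q1 q2
      have zi := K.zero i q1 q2
      have r0 := q 0
      have r1 := q 1
      have r2 := q 2
      have r3 := q 3
      have r4 := q 4
      have r5 := q 5
      simp at r0 r1 r2 r3 r4 r5
      simp only [Fin.sum_univ_six, h0, h1, h2, h3, h5, r0, r3, r4, zero_mul, mul_zero, zero_add, add_zero] at di vi
      have hpos : 0 < P i → 1 ≤ M i 1 + M i 2 := by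
        intro hp
        by_contra hcon
        have s1 : M i 1 = 0 := by omega
        have s2 : M i 2 = 0 := by omega
        rw [s1, s2, zero_mul, zero_mul] at vi
        have := Nat.mul_pos (by omega : 0 < c i) hp
        omega
      rcases fin6 i with rfl | rfl | rfl | rfl | rfl | rfl
      · exfalso
        have hp := hpos (by omega)
        have : c 0 * P 0 ≤ (M 0 1 + M 0 2 + (h - 1)) * P 0 := Nat.mul_le_mul_right _ (by omega)
        rw [add_mul, add_mul, Nat.sub_mul, h0, ← hH] at this
        rw [h0] at vi
        generalize M 0 1 = α at *
        generalize M 0 2 = β at *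
        interval_cases α <;> interval_cases β <;> omega
      · exfalso
        have := Nat.mul_le_mul_right (P 1) ti
        rw [vi, h1, zi] at this
        generalize M 1 2 = β at *
        interval_cases β <;> omega
      · omega
      · exfalso
        have := Nat.mul_le_mul_right (P 3) ti
        rw [vi, h3] at this
        generalize M 3 1 = α at *
        generalize M 3 2 = β at *
        interval_cases α <;> interval_cases β <;> omega
      · rcases hhi' with ⟨rfl, _⟩ | ⟨rfl, _⟩
        · exact ⟨rfl, r0, r1, r2, r3, hpos (by omega)⟩
        · exact absurd rfl q2
      · exact absurd rfl q1
  obtain ⟨rfl, M40, M41, M42, M43, M4⟩ := hmove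
  have v4 := K.valM 4 (by decide) (by decide)
  have z4 := K.zero 4 (by decide) (by decide)
  simp only [Fin.sum_univ_six, h0, h1, h2, h3, h5, M40, M43, z4, zero_mul, mul_zero, zero_add, add_zero] at v4
  have w4 : H + e ≤ c 4 * P 4 := by
    rw [v4]
    generalize M 4 1 = α at *
    generalize M 4 2 = β at *
    interval_cases α <;> interval_cases β <;> omega
  have zz : c 0 ≤ h → M 0 1 = 0 ∧ M 0 2 = 0 ∧ M 0 3 = 0 := by
    intro hc
    have : c 0 * d ≤ h * d := Nat.mul_le_mul_right _ hc
    rw [← hH] at this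
    refine ⟨?_, ?_, ?_⟩
    · by_contra hcon
      have := Nat.mul_le_mul_right (H + e) (by omega : 1 ≤ M 0 1)
      omega
    · by_contra hcon
      have := Nat.mul_le_mul_right (H + 2 * e) (by omega : 1 ≤ M 0 2)
      omega
    · by_contra hcon
      have := Nat.mul_le_mul_right (H + 3 * e) (by omega : 1 ≤ M 0 3)
      omega
  have hM1 : c 1 = 2 ∧ M 1 3 = 1 := by
    have hr : MRel P ![h, 0, 0, 1, 0, 0] ![0, 1, 1, 0, 0, h - 1] := by
      constructor
      · simp [Fin.sum_univ_six]; omega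
      · simp [Fin.sum_univ_six, h0, h1, h2, h3, h5]; omega
    obtain ⟨i, m, q1, q2, sd, sv, q⟩ := K.escQ (fun a => a 3 = 1 ∧ a 1 = 0 ∧ a 2 = 0) hr (by simp) (by simp)
    have ti := K.two i q1 q2
    simp [Fin.sum_univ_six, h0, h1, h2, h3, h5, ← hH] at sd sv
    have c0 : c i = h + 1 → m 0 = 0 ∧ m 1 = 0 ∧ m 2 = 0 ∧ m 3 = 0 ∧ m 4 = 0 := by omega
    rcases fin6 i with rfl | rfl | rfl | rfl | rfl | rfl
    · exfalso
      have hle : c 0 ≤ h := by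
        by_contra hcon
        have a3 : c 0 = h + 1 := by omega
        obtain ⟨m0, m1, m2, m3, m4⟩ := c0 a3
        rw [a3, h0, m0, m1, m2, m3, m4, add_mul, ← hH] at sv
        omega
      have := zz hle
      simp at q
      omega
    · simp at q
      rw [h1] at sv
      rcases q with ⟨qa, qc⟩ | ⟨qa, qd⟩
      · omega
      · by_cases hm : m 3 = 1
        · rw [hm] at sv
          have := Nat.mul_le_mul_right (H + e) (by omega : 2 ≤ c 1)
          omega
        · have : c 1 < 3 := by
            by_contra hcon
            have := Nat.mul_le_mul_right (H + e) (by omega : 3 ≤ c 1)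
            omega
          omega
    · simp at q; omega
    · exact absurd rfl q2
    · simp at q
      rcases q with ⟨qa, qc⟩ | ⟨qa, qd⟩
      · rw [qa.1] at sv; omega
      · omega
    · exact absurd rfl q1
  have hr : MRel P ![h, 0, 1, 0, 0, 0] ![0, 2, 0, 0, 0, h - 1] := by
    constructor
    · simp [Fin.sum_univ_six]; omega
    · simp [Fin.sum_univ_six, h0, h1, h2, h3, h5]; omega
  obtain ⟨i, m, q1, q2, sd, sv, q⟩ := K.escQ (fun a => a 1 = 0 ∧ a 3 = 0 ∧ (M 4 1 = 1 → a 2 = 1))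
    hr (by simp) (by simp)
  have ti := K.two i q1 q2
  simp [Fin.sum_univ_six, h0, h1, h2, h3, h5, ← hH] at sd sv
  have c0 : c i = h + 1 → m 0 = 0 ∧ m 1 = 0 ∧ m 2 = 0 ∧ m 3 = 0 ∧ m 4 = 0 := by omega
  rcases fin6 i with rfl | rfl | rfl | rfl | rfl | rfl
  · have hle : c 0 ≤ h := by
      by_contra hcon
      have a3 : c 0 = h + 1 := by omega
      obtain ⟨m0, m1, m2, m3, m4⟩ := c0 a3
      rw [a3, h0, m0, m1, m2, m3, m4, add_mul, ← hH] at sv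
      omega
    have := zz hle
    simp at q
    omega
  · simp at q; omega
  · simp at q
    rw [c2, h2] at sv
    omega
  · exact absurd rfl q2
  · simp at q
    by_cases hα : M 4 1 = 1
    · rcases q with ⟨qa, qc⟩ | ⟨qa, qd⟩
      · rw [qa.2.2 hα] at sv; omega
      · omega
    · omega
  · exact absurd rfl q1

end cases3

section cases4
set_option linter.unusedSectionVars false
set_option linter.unusedSimpArgs false

section gen
variable {ι κ : Type*} [Fintype ι] [DecidableEq ι]
variable {P : ι → ℕ} {u hi : ι} {c : ι → ℕ} {M : ι → ι → ℕ}

lemma KD.evenT (K : KD P u hi c M) {x : ι} (hx : c x = 2)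
    (hM : ∀ i, i ≠ u → i ≠ hi → i ≠ x → Even (M i x)) {a b : ι → ℕ} (hab : MRel P a b) :
    Even (a x) ↔ Even (b x) := by
  refine K.clo {a | Even (a x)} ?_ a b hab
  intro i h1 h2 m
  simp only [Set.mem_ofPred_eq, Pi.add_apply]
  by_cases hi : i = x
  · subst hi
    rw [K.zero i h1 h2, hx]
    simp [Nat.even_add]
  · have := hM i h1 h2 hi
    simp [Nat.even_add, this, Pi.single_apply, Ne.symm hi]

lemma KD.oddF (K : KD P u hi c M) {x y z : ι} (hxy : x ≠ y) (hxz : x ≠ z) (hyz : y ≠ z)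
    (hxu : x ≠ u) (hxh : x ≠ hi) (hyu : y ≠ u) (hyh : y ≠ hi) (hcy : c y = 2)
    (hMy : M y = Pi.single x 1 + Pi.single z 1) (hodd : ¬ Even (M x y))
    (hM : ∀ i, i ≠ u → i ≠ hi → i ≠ x → i ≠ y → M i x = 0 ∧ M i y = 0) : False := by
  have r1 := K.rel y hyu hyh
  rw [hcy, hMy] at r1
  have r0 := K.rel x hxu hxh
  have z0 := K.zero x hxu hxh
  have t0 := K.two x hxu hxh
  have es : (Pi.single x (c x) : ι → ℕ) = Pi.single x (c x - 1) + Pi.single x 1 := by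
    rw [← Pi.single_add]; congr; omega
  have hone : M x y = 1 := by
    by_contra hne
    have h2 : 2 ≤ M x y := by
      rcases Nat.lt_or_ge (M x y) 2 with h | h
      · exfalso
        have : M x y = 0 := by omega
        rw [this] at hodd
        exact hodd (by decide)
      · exact h
    obtain ⟨N, hN⟩ : ∃ N : ι → ℕ, M x = Pi.single y 2 + N := by
      refine ⟨fun j => if j = y then M x y - 2 else M x j, ?_⟩
      ext j
      by_cases hj : j = y
      · subst hj; simp; omega
      · simp [hj]
    have r2 : MRel P (Pi.single x (c x)) ((Pi.single z 1 + N) + Pi.single x 1) := by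
      have := r1.add_right N
      rw [← hN] at this
      have := r0.trans this
      convert this using 1
      abel
    rw [es] at r2
    have := K.min x hxu hxh _ _ (by omega) r2.cancel
    have := congrFun this z
    simp [Ne.symm hxz] at this
  obtain ⟨N, hN⟩ : ∃ N : ι → ℕ, M x = Pi.single y 1 + N := by
    refine ⟨fun j => if j = y then M x y - 1 else M x j, ?_⟩
    ext j
    by_cases hj : j = y
    · subst hj; simp; omega
    · simp [hj]
  have hNx : N x = 0 := by
    have := congrFun hN x
    simp [z0, hxy] at this
    exact this.symm
  have hNy : N y = 0 := by
    have := congrFun hN y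
    simp [hone] at this
    omega
  have r2 : MRel P (Pi.single x (c x - 1) + Pi.single y 1) (Pi.single z 1 + N) := by
    have h1 := r0.add_right (Pi.single y 1)
    have h2 := r1.add_right N
    have e1 : M x + Pi.single y 1 = Pi.single y 2 + N := by
      rw [hN, show (2 : ℕ) = 1 + 1 from rfl, Pi.single_add]; abel
    rw [e1] at h1
    have h3 := h1.trans h2
    rw [es] at h3
    apply MRel.cancel (m := Pi.single x 1)
    convert h3 using 1 <;> abel
  have := K.clo {a | a x = 0 ∧ a y = 0} ?_ _ _ r2
  · simp [hxy, hxz, hyz, hNx, hNy, hxy.symm] at this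
  · intro i h1 h2 m
    simp only [Set.mem_ofPred_eq, Pi.add_apply]
    by_cases hix : i = x
    · subst hix
      simp [hone]; omega
    · by_cases hiy : i = y
      · subst hiy
        simp [hMy, hcy]
      · obtain ⟨q1, q2⟩ := hM i h1 h2 hix hiy
        simp [q1, q2, Ne.symm hix, Ne.symm hiy]

end gen

lemma case4dup {P : Fin 4 → ℕ} {c : Fin 4 → ℕ} {M : Fin 4 → Fin 4 → ℕ}
    (K : KD P 3 2 c M) (hP : Function.Injective P)
    (d h e : ℕ) (hd : 0 < d) (hh : 1 ≤ h) (he : 0 < e)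
    (h0 : P 0 = d) (h1 : P 1 = h * d + e) (h2 : P 2 = h * d + 2 * e) (h3 : P 3 = 0) :
    h = 1 ∧ Even d := by
  have hone : h = 1 := by
    by_contra hne
    obtain ⟨H, hH⟩ : ∃ H, H = h * d := ⟨_, rfl⟩
    have hH2 : 2 * d ≤ H := by rw [hH]; exact Nat.mul_le_mul_right _ (by omega)
    rw [← hH] at h1 h2
    have hr : MRel P ![0, 2, 0, h - 1] ![h, 0, 1, 0] := by
      constructor
      · simp [Fin.sum_univ_four]; omega
      · simp [Fin.sum_univ_four, h0, h1, h2, h3]; omega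
    obtain ⟨i, q1, q2, q⟩ := K.move hr (by
      intro hne
      have := congrFun hne 1
      simp at this)
    have ti := K.two i q1 q2
    have di := K.degM i q1 q2
    have vi := K.valM i q1 q2
    have zi := K.zero i q1 q2
    simp only [Fin.sum_univ_four, h0, h1, h2, h3, zero_mul, mul_zero, zero_add, add_zero] at di vi
    rcases q with q | q
    · rcases fin4 i with rfl | rfl | rfl | rfl <;> simp at q q1 q2
      · omega
      · have hc : c 1 = 2 := by omega
        rw [hc, h1, zi] at vi
        rw [hc, zi] at di
        have b0 : M 1 0 ≤ 2 := by omega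
        have b2 : M 1 2 ≤ 2 := by omega
        generalize M 1 0 = p at *
        generalize M 1 2 = q at *
        interval_cases p <;> interval_cases q <;> omega
    · have r0 := q 0
      have r1 := q 1
      have r2 := q 2
      have r3 := q 3
      simp at r0 r1 r2 r3
      rw [r0, r2] at vi di
      rcases fin4 i with rfl | rfl | rfl | rfl
      · have : c 0 * P 0 ≤ (M 0 1 + (h - 1)) * P 0 := Nat.mul_le_mul_right _ (by omega)
        have hp := Nat.mul_pos (by omega : 0 < c 0) hd
        rw [add_mul, Nat.sub_mul, h0, ← hH] at this
        rw [h0] at vi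
        generalize M 0 1 = α at *
        interval_cases α <;> omega
      · have hp := Nat.mul_pos (by omega : 0 < c 1) (by omega : 0 < P 1)
        rw [zi] at vi
        omega
      · exact q2 rfl
      · exact q1 rfl
  refine ⟨hone, ?_⟩
  subst hone
  obtain ⟨c1, M1⟩ := K.mid hP (p := 0) (j := 1) (s := 2) (by decide) (by decide) (by omega)
  by_cases hev : Even (M 0 1)
  · have hr : MRel P ![0, d, 0, d + e] ![d + e, 0, 0, d] := by
      constructor
      · simp [Fin.sum_univ_four]; omega
      · simp [Fin.sum_univ_four, h0, h1, h2, h3]; ring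
    have := K.evenT c1 (by
      intro i a1 a2 a3
      rcases fin4 i with rfl | rfl | rfl | rfl
      · exact hev
      · exact absurd rfl a3
      · exact absurd rfl a2
      · exact absurd rfl a1) hr
    simpa using this
  · exfalso
    refine K.oddF (x := 0) (y := 1) (z := 2) (by decide) (by decide) (by decide) (by decide)
      (by decide) (by decide) (by decide) c1 M1 hev ?_
    intro i a1 a2 a3 a4
    rcases fin4 i with rfl | rfl | rfl | rfl
    · exact absurd rfl a3
    · exact absurd rfl a4
    · exact absurd rfl a2
    · exact absurd rfl a1

end cases4

section cases5
set_option linter.unusedSectionVars false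
set_option linter.unusedSimpArgs false

/-- (1) holds when `M 0` is supported on the extremes. -/
lemma case4one_C {P : Fin 5 → ℕ} {c : Fin 5 → ℕ} {M : Fin 5 → Fin 5 → ℕ}
    (K : KD P 4 2 c M) (hP : Function.Injective P) (d e : ℕ) (hd : 0 < d) (he : 0 < e)
    (h0 : P 0 = d) (h1 : P 1 = d + e) (h2 : P 2 = d + 2 * e) (h4 : P 4 = 0)
    (hg : Nat.gcd (Nat.gcd d (d + e)) (P 3) = 1)
    (c1 : c 1 = 2) (M1 : M 1 = Pi.single 0 1 + Pi.single 2 1)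
    (M01 : M 0 1 = 0) (M03 : M 0 3 = 0) :
    (Even (d / Nat.gcd d (d + e)) ∧ ∃ β₁ β₂ β₃ : ℕ, Nat.gcd d (d + e) * P 3 =
        β₁ * d + β₂ * (d + e) + β₃ * (d + 2 * e) ∧ β₁ + β₂ + β₃ ≤ Nat.gcd d (d + e)) := by
  have t3 := K.two 3 (by decide) (by decide)
  have d3 := K.degM 3 (by decide) (by decide)
  have v3 := K.valM 3 (by decide) (by decide)
  have z3 := K.zero 3 (by decide) (by decide)
  simp only [Fin.sum_univ_five, h0, h1, h2, h4, z3, zero_mul, mul_zero, zero_add, add_zero] at d3 v3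
  obtain ⟨g, hgdef⟩ : ∃ g, g = Nat.gcd d (d + e) := ⟨_, rfl⟩
  rw [← hgdef] at hg ⊢
  have gd : g ∣ d := hgdef ▸ Nat.gcd_dvd_left _ _
  have gd2 : g ∣ d + e := hgdef ▸ Nat.gcd_dvd_right _ _
  have ge : g ∣ e := (Nat.dvd_add_right gd).1 gd2
  have gpos : 0 < g := Nat.pos_of_dvd_of_pos gd hd
  have hc3 : c 3 = g := by
    apply Nat.dvd_antisymm
    · obtain ⟨s, t, hst⟩ : ∃ s t : ℕ, s * d = t * (d + e) + g := by
        have hz := Nat.gcd_eq_gcd_ab d (d + e)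
        rw [← hgdef] at hz
        set a := Nat.gcdA d (d + e)
        set b := Nat.gcdB d (d + e)
        -- shift by a large multiple
        refine ⟨(a + (d + e) * (|a| + |b|)).toNat, (-b + d * (|a| + |b|)).toNat, ?_⟩
        have p1 : 0 ≤ a + (d + e) * (|a| + |b|) := by
          have := neg_abs_le a
          have := abs_nonneg b
          have := abs_nonneg a
          have : (1 : ℤ) ≤ d := by exact_mod_cast hd
          have : (0 : ℤ) ≤ e := by positivity
          nlinarith
        have p2 : 0 ≤ -b + d * (|a| + |b|) := by
          have := le_abs_self b
          have := abs_nonneg b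
          have := abs_nonneg a
          have : (1 : ℤ) ≤ d := by exact_mod_cast hd
          nlinarith
        zify
        rw [Int.toNat_of_nonneg p1, Int.toNat_of_nonneg p2, hz]
        push_cast
        ring
      have hr : MRel P ![0, t * P 3, 0, g, s * P 3] ![s * P 3, 0, 0, 0, g + t * P 3] := by
        constructor
        · simp [Fin.sum_univ_five]; ring
        · simp [Fin.sum_univ_five, h0, h1, h2, h4]
          calc t * P 3 * (d + e) + g * P 3 = (t * (d + e) + g) * P 3 := by ring
            _ = s * P 3 * d := by rw [← hst]; ring
      have := K.clo {a | c 3 ∣ a 3} ?_ _ _ hr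
      · simpa using this
      · intro i q1 q2 m
        rcases fin5 i with rfl | rfl | rfl | rfl | rfl
        · simp [M03]
        · simp [M1]
        · exact absurd rfl q2
        · simp [z3]
        · exact absurd rfl q1
    · have : g ∣ c 3 * P 3 := by
        rw [v3]
        refine dvd_add (dvd_add (Dvd.dvd.mul_left gd _) (Dvd.dvd.mul_left gd2 _))
          (Dvd.dvd.mul_left (dvd_add gd (Dvd.dvd.mul_left ge _)) _)
      exact Nat.Coprime.dvd_of_dvd_mul_right hg this
  refine ⟨?_, M 3 0, M 3 1, M 3 2, ?_, ?_⟩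
  · have hr : MRel P ![0, d / g, 0, 0, (d + e) / g] ![(d + e) / g, 0, 0, 0, d / g] := by
      obtain ⟨p, hp⟩ := gd
      obtain ⟨q, hq⟩ := gd2
      have e1 : d / g = p := by rw [hp]; exact Nat.mul_div_cancel_left _ gpos
      have e2 : (d + e) / g = q := by rw [hq]; exact Nat.mul_div_cancel_left _ gpos
      rw [e1, e2]
      constructor
      · simp [Fin.sum_univ_five]; omega
      · simp [Fin.sum_univ_five, h0, h1, h2, h4]
        rw [hq, hp]; ring
    have := K.clo {a | Even (a 1 + M 3 1 * (a 3 / c 3))} ?_ _ _ hr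
    · simpa using this
    · intro i q1 q2 m
      rcases fin5 i with rfl | rfl | rfl | rfl | rfl
      · simp [M03, M01]
      · simp [M1, c1, add_assoc]
        simp [Nat.even_add]
      · exact absurd rfl q2
      · simp [z3]
        rw [Nat.add_div_left _ (by omega)]
        have : m 1 + M 3 1 * (m 3 / c 3).succ = M 3 1 + m 1 + M 3 1 * (m 3 / c 3) := by
          rw [Nat.succ_eq_add_one]; ring
        rw [this]
      · exact absurd rfl q1
  · rw [← hc3, v3]
  · omega

/-- (2) holds when all coordinates are even. -/
lemma case4one_E {P : Fin 5 → ℕ} {hi : Fin 5} {c : Fin 5 → ℕ} {M : Fin 5 → Fin 5 → ℕ}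
    (K : KD P 4 hi c M) (d e : ℕ) (j : Fin 5)
    (hj : (hi = 2 ∧ j = 3) ∨ (hi = 3 ∧ j = 2))
    (h0 : P 0 = d) (h1 : P 1 = d + e) (h2 : P 2 = d + 2 * e) (h4 : P 4 = 0)
    (c1 : c 1 = 2) (M1 : M 1 = Pi.single 0 1 + Pi.single 2 1)
    (ev0 : Even (M 0 1)) (evj : Even (M j 1)) :
    Even d ∧ Even (P 3) ∧ ∃ R : Fin 2 → (Fin 4 → ℕ) × (Fin 4 → ℕ),
      Gens ![d, d + 2 * e, P 3, 0] R := by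
  have hint : ∀ i, i ≠ 4 → i ≠ hi → i = 0 ∨ i = 1 ∨ i = j := by
    intro i a1 a2
    rcases hj with ⟨rfl, rfl⟩ | ⟨rfl, rfl⟩ <;> rcases fin5 i with rfl | rfl | rfl | rfl | rfl <;>
      simp at a1 a2 ⊢
  have n0 : (0 : Fin 5) ≠ hi := by rcases hj with ⟨rfl, rfl⟩ | ⟨rfl, rfl⟩ <;> decide
  have n1 : (1 : Fin 5) ≠ hi := by rcases hj with ⟨rfl, rfl⟩ | ⟨rfl, rfl⟩ <;> decide
  have nj : j ≠ hi := by rcases hj with ⟨rfl, rfl⟩ | ⟨rfl, rfl⟩ <;> decide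
  have j4 : j ≠ 4 := by rcases hj with ⟨rfl, rfl⟩ | ⟨rfl, rfl⟩ <;> decide
  have j1 : j ≠ 1 := by rcases hj with ⟨rfl, rfl⟩ | ⟨rfl, rfl⟩ <;> decide
  have hev : ∀ {a b : Fin 5 → ℕ}, MRel P a b → (Even (a 1) ↔ Even (b 1)) := by
    intro a b hab
    refine K.evenT c1 ?_ hab
    intro i a1 a2 a3
    rcases hint i a1 a2 with rfl | rfl | rfl
    · exact ev0
    · exact absurd rfl a3
    · exact evj
  refine ⟨?_, ?_, ?_⟩
  · have hr : MRel P ![0, d, 0, 0, d + e] ![d + e, 0, 0, 0, d] := by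
      constructor
      · simp [Fin.sum_univ_five]; omega
      · simp [Fin.sum_univ_five, h0, h1, h2, h4]; ring
    simpa using hev hr
  · have hr : MRel P ![0, P 3, 0, 0, d + e] ![0, 0, 0, d + e, P 3] := by
      constructor
      · simp [Fin.sum_univ_five]; omega
      · simp [Fin.sum_univ_five, h0, h1, h2, h4]; ring
    simpa using hev hr
  · let φ : (Fin 5 → ℕ) → (Fin 4 → ℕ) := fun a => ![a 0 + a 1 / 2, a 2 + a 1 / 2, a 3, a 4]
    have φrel : ∀ a b, MRel P a b → Even (a 1) → Even (b 1) →
        MRel ![d, d + 2 * e, P 3, 0] (φ a) (φ b) := by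
      rintro a b ⟨r1, r2⟩ ⟨s, hs⟩ ⟨t, ht⟩
      have hs' : a 1 / 2 = s := by omega
      have ht' : b 1 / 2 = t := by omega
      simp [Fin.sum_univ_five, h0, h1, h2, h4, hs, ht] at r1 r2
      constructor
      · simp [Fin.sum_univ_four, φ, hs', ht']; omega
      · simp [Fin.sum_univ_four, φ, hs', ht']; linarith
    have φadd : ∀ a b, Even (a 1) → φ (a + b) = φ a + φ b := by
      rintro a b ⟨s, hs⟩
      have : (a 1 + b 1) / 2 = a 1 / 2 + b 1 / 2 := by omega
      ext i
      rcases fin4 i with rfl | rfl | rfl | rfl <;> simp [φ, this] <;> omega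
    have hsing : ∀ i s, i ≠ 1 → Even ((Pi.single i s : Fin 5 → ℕ) 1) := by
      intro i s hi
      simp [Pi.single_apply, Ne.symm hi]
    refine ⟨fun r => if r = 0 then (φ (Pi.single 0 (c 0)), φ (M 0)) else
      (φ (Pi.single j (c j)), φ (M j)), ?_, ?_⟩
    · intro r
      by_cases hr : r = 0
      · simp only [hr, if_true]
        exact φrel _ _ (K.rel 0 (by decide) n0) (hsing _ _ (by decide)) ev0
      · simp only [hr, if_false]
        exact φrel _ _ (K.rel j j4 nj) (hsing _ _ j1) evj
    · intro T hT a b hab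
      let L : (Fin 4 → ℕ) → (Fin 5 → ℕ) := fun a => ![a 0, 0, a 1, a 2, a 3]
      have φL : ∀ a, φ (L a) = a := by
        intro a
        ext i
        rcases fin4 i with rfl | rfl | rfl | rfl <;> simp [φ, L]
      have hL : MRel P (L a) (L b) := by
        obtain ⟨r1, r2⟩ := hab
        simp [Fin.sum_univ_four] at r1 r2
        constructor
        · simp [Fin.sum_univ_five, L]; omega
        · simp [Fin.sum_univ_five, L, h0, h1, h2, h4]; omega
      have := K.clo {x | Even (x 1) ∧ φ x ∈ T} ?_ _ _ hL
      · simpa [φL, L] using this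
      · intro i a1 a2 m
        have gen : ∀ A B : Fin 5 → ℕ, Even (A 1) → Even (B 1) →
            (∀ m, φ A + m ∈ T ↔ φ B + m ∈ T) →
            (A + m ∈ {x | Even (x 1) ∧ φ x ∈ T} ↔ B + m ∈ {x | Even (x 1) ∧ φ x ∈ T}) := by
          intro A B hA hB h
          simp only [Set.mem_ofPred_eq, φadd A m hA, φadd B m hB, Pi.add_apply]
          rw [h (φ m)]
          simp [Nat.even_add, hA, hB]
        rcases hint i a1 a2 with rfl | rfl | rfl
        · refine gen _ _ (hsing _ _ (by decide)) ev0 ?_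
          intro m
          have := hT 0 m
          simpa using this
        · refine gen _ _ (by simp [c1]) (by simp [M1]) ?_
          intro m
          have : φ (Pi.single 1 (c 1)) = φ (M 1) := by
            ext i
            rcases fin4 i with rfl | rfl | rfl | rfl <;> simp [φ, M1, c1]
          rw [this]
        · refine gen _ _ (hsing _ _ j1) evj ?_
          intro m
          have := hT 1 m
          simpa using this

lemma case4one {P : Fin 5 → ℕ} {hi : Fin 5} {c : Fin 5 → ℕ} {M : Fin 5 → Fin 5 → ℕ}
    (K : KD P 4 hi c M) (hP : Function.Injective P) (hhi : ∀ i, P i ≤ P hi)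
    (d e : ℕ) (hd : 0 < d) (he : 0 < e)
    (h0 : P 0 = d) (h1 : P 1 = d + e) (h2 : P 2 = d + 2 * e) (h4 : P 4 = 0)
    (hg : Nat.gcd (Nat.gcd d (d + e)) (P 3) = 1) :
    (Even (d / Nat.gcd d (d + e)) ∧ ∃ β₁ β₂ β₃ : ℕ, Nat.gcd d (d + e) * P 3 =
        β₁ * d + β₂ * (d + e) + β₃ * (d + 2 * e) ∧ β₁ + β₂ + β₃ ≤ Nat.gcd d (d + e)) ∨
    (Even d ∧ Even (P 3) ∧ ∃ R : Fin 2 → (Fin 4 → ℕ) × (Fin 4 → ℕ),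
      Gens ![d, d + 2 * e, P 3, 0] R) := by
  obtain ⟨c1, M1⟩ := K.mid hP (p := 0) (j := 1) (s := 2) (by decide) (by decide) (by omega)
  have hj : ∃ j : Fin 5, (hi = 2 ∧ j = 3) ∨ (hi = 3 ∧ j = 2) := by
    have a1 := hhi 2
    have a2 := hhi 3
    rcases fin5 hi with rfl | rfl | rfl | rfl | rfl
    · omega
    · omega
    · exact ⟨3, Or.inl ⟨rfl, rfl⟩⟩
    · exact ⟨2, Or.inr ⟨rfl, rfl⟩⟩
    · omega
  obtain ⟨j, hj⟩ := hj
  have hint : ∀ i, i ≠ 4 → i ≠ hi → i = 0 ∨ i = 1 ∨ i = j := by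
    intro i a1 a2
    rcases hj with ⟨rfl, rfl⟩ | ⟨rfl, rfl⟩ <;> rcases fin5 i with rfl | rfl | rfl | rfl | rfl <;>
      simp at a1 a2 ⊢
  have n0 : (0 : Fin 5) ≠ hi := by rcases hj with ⟨rfl, rfl⟩ | ⟨rfl, rfl⟩ <;> decide
  have n1 : (1 : Fin 5) ≠ hi := by rcases hj with ⟨rfl, rfl⟩ | ⟨rfl, rfl⟩ <;> decide
  have n4 : (4 : Fin 5) ≠ hi := by rcases hj with ⟨rfl, rfl⟩ | ⟨rfl, rfl⟩ <;> decide
  have hext : (∀ k, k ≠ hi → k ≠ 4 → M 0 k = 0) ∨ (∀ k, k ≠ hi → k ≠ 4 → M j k = 0) := by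
    have hr : MRel P (Pi.single hi d + Pi.single 4 (P hi - d)) (Pi.single 0 (P hi)) := by
      have := hhi 0
      constructor
      · simp [Finset.sum_add_distrib]; omega
      · simp [Pi.single_apply, ite_mul, add_mul, Finset.sum_add_distrib, h4, h0]; ring
    obtain ⟨i, a1, a2, a⟩ := K.move hr (by
      intro h
      have := congrFun h 0
      have h5 := hhi 0
      simp [n0] at this
      omega)
    have ti := K.two i a1 a2
    rcases a with a | a
    · simp [Pi.single_apply, a1, a2] at a; omega
    · have hz : ∀ k, k ≠ hi → k ≠ 4 → M i k = 0 := by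
        intro k b1 b2
        have := a k
        simpa [Pi.single_apply, b1, b2] using this
      rcases hint i a1 a2 with rfl | rfl | rfl
      · exact Or.inl hz
      · have := hz 0 n0 (by decide)
        simp [M1] at this
      · exact Or.inr hz
  by_cases ev0 : Even (M 0 1)
  · by_cases evj : Even (M j 1)
    · right
      exact case4one_E K d e j hj h0 h1 h2 h4 c1 M1 ev0 evj
    · have hM0 : ∀ k, k ≠ hi → k ≠ 4 → M 0 k = 0 := by
        rcases hext with h | h
        · exact h
        · exfalso
          apply evj
          rw [h 1 n1 (by decide)]; decide
      rcases hj with ⟨rfl, rfl⟩ | ⟨rfl, rfl⟩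
      · left
        exact case4one_C K hP d e hd he h0 h1 h2 h4 hg c1 M1 (hM0 1 (by decide) (by decide))
          (hM0 3 (by decide) (by decide))
      · exfalso
        refine K.oddF (x := 2) (y := 1) (z := 0) (by decide) (by decide) (by decide) (by decide)
          (by decide) (by decide) (by decide) c1 (by rw [M1, add_comm]) evj ?_
        intro i a1 a2 a3 a4
        rcases hint i a1 a2 with rfl | rfl | rfl
        · exact ⟨hM0 2 (by decide) (by decide), hM0 1 (by decide) (by decide)⟩
        · exact absurd rfl a4
        · exact absurd rfl a3
  · exfalso
    have hMj : ∀ k, k ≠ hi → k ≠ 4 → M j k = 0 := by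
      rcases hext with h | h
      · exfalso
        apply ev0
        rw [h 1 n1 (by decide)]; decide
      · exact h
    refine K.oddF (x := 0) (y := 1) (z := 2) (by decide) (by decide) (by decide) (by decide)
      n0 (by decide) n1 c1 M1 ev0 ?_
    intro i a1 a2 a3 a4
    rcases hint i a1 a2 with rfl | rfl | rfl
    · exact absurd rfl a3
    · exact absurd rfl a4
    · exact ⟨hMj 0 n0 (by decide), hMj 1 n1 (by decide)⟩

end cases5

section cases6
set_option linter.unusedSectionVars false
set_option linter.unusedSimpArgs false

lemma stage {ι : Type*} [Fintype ι] [DecidableEq ι] {P : ι → ℕ} (T : Set (ι → ℕ)) (i : ι) (c : ℕ)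
    (M : ι → ℕ) (hc : 0 < c) (hM : M i = 0) (hr : MRel P (Pi.single i c) M)
    (hT : ∀ m, Pi.single i c + m ∈ T ↔ M + m ∈ T) (a : ι → ℕ) :
    ∃ a', MRel P a a' ∧ (a ∈ T ↔ a' ∈ T) ∧ a' i < c ∧ ∀ j, j ≠ i → M j = 0 → a' j = a j := by
  obtain ⟨s, hs⟩ : ∃ s, a i = s := ⟨_, rfl⟩
  induction s using Nat.strong_induction_on generalizing a with
  | _ s ih =>
    by_cases hlt : a i < c
    · exact ⟨a, ⟨rfl, rfl⟩, Iff.rfl, hlt, fun _ _ _ => rfl⟩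
    · obtain ⟨m, hm⟩ : ∃ m : ι → ℕ, a = Pi.single i c + m := by
        refine ⟨fun j => if j = i then a i - c else a j, ?_⟩
        ext j
        by_cases hj : j = i
        · subst hj; simp; omega
        · simp [hj]
      have hmi : a i = c + m i := by rw [hm]; simp
      obtain ⟨a', q1, q2, q3, q4⟩ := ih ((M + m) i) (by simp [hM]; omega) (M + m) rfl
      refine ⟨a', ?_, ?_, q3, ?_⟩
      · rw [hm]; exact (hr.add_right m).trans q1
      · rw [hm, hT m, q2]
      · intro j hj hj0
        rw [q4 j hj hj0, hm]
        simp [hj, hj0]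

lemma suff1 {P : Fin 5 → ℕ} (d e : ℕ) (hd : 0 < d) (he : 0 < e)
    (h0 : P 0 = d) (h1 : P 1 = d + e) (h2 : P 2 = d + 2 * e) (h4 : P 4 = 0)
    (hg : Nat.gcd (Nat.gcd d (d + e)) (P 3) = 1) (hev : Even (d / Nat.gcd d (d + e)))
    (β₁ β₂ β₃ : ℕ) (hβ : Nat.gcd d (d + e) * P 3 = β₁ * d + β₂ * (d + e) + β₃ * (d + 2 * e))
    (hβ' : β₁ + β₂ + β₃ ≤ Nat.gcd d (d + e)) :
    ∃ R : Fin 3 → (Fin 5 → ℕ) × (Fin 5 → ℕ), Gens P R := by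
  obtain ⟨g, hgdef⟩ : ∃ g, g = Nat.gcd d (d + e) := ⟨_, rfl⟩
  rw [← hgdef] at hg hβ hβ' hev
  have gd : g ∣ d := hgdef ▸ Nat.gcd_dvd_left _ _
  have gd2 : g ∣ d + e := hgdef ▸ Nat.gcd_dvd_right _ _
  have ge : g ∣ e := (Nat.dvd_add_right gd).1 gd2
  have gpos : 0 < g := Nat.pos_of_dvd_of_pos gd hd
  have hgde : g = Nat.gcd d e := by rw [hgdef]; simp
  obtain ⟨ε, hε⟩ := ge
  obtain ⟨w, hw⟩ := gd
  have : d / g = w := by rw [hw]; exact Nat.mul_div_cancel_left _ gpos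
  rw [this] at hev
  obtain ⟨f, hf⟩ := hev
  have hcop : Nat.Coprime w ε := by
    have h5 : g * Nat.gcd w ε = g * 1 := by
      rw [mul_one, ← Nat.gcd_mul_left, ← hw, ← hε, ← hgde]
    exact Nat.eq_of_mul_eq_mul_left gpos h5
  have hcf : Nat.Coprime f ε := hcop.coprime_dvd_left ⟨2, by omega⟩
  have hc2 : Nat.Coprime 2 ε := hcop.coprime_dvd_left ⟨f, by omega⟩
  have εpos : 0 < ε := by
    rcases Nat.eq_zero_or_pos ε with h | h
    · rw [h] at hε; omega
    · exact h
  let R : Fin 3 → (Fin 5 → ℕ) × (Fin 5 → ℕ) := ![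
    (Pi.single 3 g, ![β₁, β₂, β₃, 0, g - (β₁ + β₂ + β₃)]),
    (Pi.single 1 2, ![1, 0, 1, 0, 0]),
    (Pi.single 0 (f + ε), ![0, 0, f, 0, ε])]
  have r0 : MRel P (Pi.single 3 g) ![β₁, β₂, β₃, 0, g - (β₁ + β₂ + β₃)] := by
    constructor
    · simp [Fin.sum_univ_five]; omega
    · simp [Fin.sum_univ_five, h0, h1, h2, h4, hβ]
  have r1 : MRel P (Pi.single 1 2) ![1, 0, 1, 0, 0] := by
    constructor
    · simp [Fin.sum_univ_five]
    · simp [Fin.sum_univ_five, h0, h1, h2, h4]; omega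
  have r2 : MRel P (Pi.single 0 (f + ε)) ![0, 0, f, 0, ε] := by
    constructor
    · simp [Fin.sum_univ_five]
    · simp [Fin.sum_univ_five, h0, h1, h2, h4]
      rw [hw, hε, hf]; ring
  refine ⟨R, ?_, ?_⟩
  · intro j
    fin_cases j
    · exact r0
    · exact r1
    · exact r2
  · intro T hT
    have norm : ∀ a : Fin 5 → ℕ, ∃ a', MRel P a a' ∧ (a ∈ T ↔ a' ∈ T) ∧ a' 3 < g ∧ a' 1 < 2 ∧
        a' 0 < f + ε := by
      intro a
      obtain ⟨a1, p1, p2, p3, p4⟩ := stage T 3 g _ gpos (by simp) r0 (hT 0) a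
      obtain ⟨a2, q1, q2, q3, q4⟩ := stage T 1 2 _ (by omega) (by simp) r1 (hT 1) a1
      obtain ⟨a3, s1, s2, s3, s4⟩ := stage T 0 (f + ε) _ (by omega) (by simp) r2 (hT 2) a2
      refine ⟨a3, (p1.trans q1).trans s1, (p2.trans q2).trans s2, ?_, ?_, s3⟩
      · rw [s4 3 (by decide) (by simp), q4 3 (by decide) (by simp)]; exact p3
      · rw [s4 1 (by decide) (by simp)]; exact q3
    intro a b hab
    obtain ⟨a', p1, p2, p3, p4, p5⟩ := norm a
    obtain ⟨b', q1, q2, q3, q4, q5⟩ := norm b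
    rw [p2, q2]
    obtain ⟨s1, s2⟩ := (p1.symm.trans hab).trans q1
    simp [Fin.sum_univ_five, h0, h1, h2, h4] at s1 s2
    have e3 : a' 3 = b' 3 := by
      have k1 : g * (a' 0 * w + a' 1 * (w + ε) + a' 2 * (w + 2 * ε)) + a' 3 * P 3 =
        g * (b' 0 * w + b' 1 * (w + ε) + b' 2 * (w + 2 * ε)) + b' 3 * P 3 := by
        rw [hw, hε] at s2; linarith
      have k2 : a' 3 * P 3 ≡ b' 3 * P 3 [MOD g] := by
        have := congrArg (· % g) k1
        simpa [Nat.ModEq, Nat.mul_add_mod] using this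
      have k3 := Nat.ModEq.cancel_right_of_coprime hg k2
      exact Nat.ModEq.eq_of_lt_of_lt k3 p3 q3
    have s3 : a' 0 * w + a' 1 * (w + ε) + a' 2 * (w + 2 * ε) =
        b' 0 * w + b' 1 * (w + ε) + b' 2 * (w + 2 * ε) := by
      rw [hw, hε, e3] at s2
      apply Nat.eq_of_mul_eq_mul_left gpos
      linarith
    have e1 : a' 1 = b' 1 := by
      have k1 : 2 * (a' 0 * f + a' 1 * f + a' 2 * (f + ε)) + a' 1 * ε =
        2 * (b' 0 * f + b' 1 * f + b' 2 * (f + ε)) + b' 1 * ε := by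
        rw [hf] at s3; linarith
      have k2 : a' 1 * ε ≡ b' 1 * ε [MOD 2] := by
        have := congrArg (· % 2) k1
        simpa [Nat.ModEq, Nat.mul_add_mod] using this
      have k3 := Nat.ModEq.cancel_right_of_coprime hc2 k2
      exact Nat.ModEq.eq_of_lt_of_lt k3 p4 q4
    have s4 : (f + ε) * a' 2 + a' 0 * f = (f + ε) * b' 2 + b' 0 * f := by
      rw [hf, e1] at s3; linarith
    have e0 : a' 0 = b' 0 := by
      have k2 : a' 0 * f ≡ b' 0 * f [MOD (f + ε)] := by
        have := congrArg (· % (f + ε)) s4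
        simpa [Nat.ModEq, Nat.mul_add_mod] using this
      have k3 := Nat.ModEq.cancel_right_of_coprime (by
        rw [Nat.gcd_comm]; simpa using hcf) k2
      exact Nat.ModEq.eq_of_lt_of_lt k3 p5 q5
    have e2 : a' 2 = b' 2 := by
      rw [e0] at s4
      exact Nat.eq_of_mul_eq_mul_left (by omega : 0 < f + ε) (by omega)
    have : a' = b' := by
      ext i
      rcases fin5 i with rfl | rfl | rfl | rfl | rfl <;> omega
    rw [this]

lemma suff2 {P : Fin 5 → ℕ} (d e : ℕ)
    (h0 : P 0 = d) (h1 : P 1 = d + e) (h2 : P 2 = d + 2 * e) (h4 : P 4 = 0)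
    (hg : Nat.gcd (Nat.gcd d (d + e)) (P 3) = 1) (hev : Even d) (hev3 : Even (P 3))
    (R' : Fin 2 → (Fin 4 → ℕ) × (Fin 4 → ℕ)) (hR' : Gens ![d, d + 2 * e, P 3, 0] R') :
    ∃ R : Fin 3 → (Fin 5 → ℕ) × (Fin 5 → ℕ), Gens P R := by
  have hodd : ¬ Even (d + e) := by
    intro h
    have : 2 ∣ 1 := by
      rw [← hg]
      exact Nat.dvd_gcd (Nat.dvd_gcd hev.two_dvd h.two_dvd) hev3.two_dvd
    omega
  let L : (Fin 4 → ℕ) → (Fin 5 → ℕ) := fun a => ![a 0, 0, a 1, a 2, a 3]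
  have Ladd : ∀ a b, L (a + b) = L a + L b := by
    intro a b
    ext i
    rcases fin5 i with rfl | rfl | rfl | rfl | rfl <;> simp [L]
  have hL : ∀ a b, MRel ![d, d + 2 * e, P 3, 0] a b → MRel P (L a) (L b) := by
    intro a b hab
    obtain ⟨r1, r2⟩ := hab
    simp [Fin.sum_univ_four] at r1 r2
    constructor
    · simp [Fin.sum_univ_five, L]; omega
    · simp [Fin.sum_univ_five, L, h0, h1, h2, h4]; omega
  have r1 : MRel P (Pi.single 1 2) ![1, 0, 1, 0, 0] := by
    constructor
    · simp [Fin.sum_univ_five]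
    · simp [Fin.sum_univ_five, h0, h1, h2, h4]; omega
  refine ⟨![(Pi.single 1 2, ![1, 0, 1, 0, 0]), (L (R' 0).1, L (R' 0).2), (L (R' 1).1, L (R' 1).2)],
    ?_, ?_⟩
  · intro j
    fin_cases j
    · exact r1
    · exact hL _ _ (hR'.1 0)
    · exact hL _ _ (hR'.1 1)
  · intro T hT a b hab
    obtain ⟨a', p1, p2, p3, -⟩ := stage T 1 2 _ (by omega) (by simp) r1 (hT 0) a
    obtain ⟨b', q1, q2, q3, -⟩ := stage T 1 2 _ (by omega) (by simp) r1 (hT 0) b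
    rw [p2, q2]
    obtain ⟨s1, s2⟩ := (p1.symm.trans hab).trans q1
    simp [Fin.sum_univ_five, h0, h1, h2, h4] at s1 s2
    have e1 : a' 1 = b' 1 := by
      have := congrArg Even s2
      have ev2 : Even (d + 2 * e) := by simp [Nat.even_add, hev]
      simp only [Nat.even_add, Nat.even_mul, hev, hev3, ev2, or_true, true_iff, iff_true] at this
      simp only [Nat.even_add, hev, true_iff] at hodd
      simp only [hodd, or_false, eq_iff_iff, iff_false, false_iff, iff_true, true_iff] at this
      rw [Nat.even_iff, Nat.even_iff] at this
      omega
    let D : (Fin 5 → ℕ) → (Fin 4 → ℕ) := fun a => ![a 0, a 2, a 3, a 4]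
    have hD : ∀ x : Fin 5 → ℕ, L (D x) + Pi.single 1 (x 1) = x := by
      intro x
      ext i
      rcases fin5 i with rfl | rfl | rfl | rfl | rfl <;> simp [L, D]
    have := hR'.2 {x | L x + Pi.single 1 (a' 1) ∈ T} ?_ (D a') (D b') ?_
    · simp only [Set.mem_ofPred_eq] at this
      rw [hD, e1, hD] at this
      exact this
    · intro j m
      simp only [Set.mem_ofPred_eq, Ladd, add_assoc]
      fin_cases j
      · exact hT 1 _
      · exact hT 2 _
    · constructor
      · simp [Fin.sum_univ_four, D]; omega
      · simp [Fin.sum_univ_four, D]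
        rw [e1] at s2; omega

end cases6

section cases7
set_option linter.unusedSectionVars false
set_option linter.unusedSimpArgs false

lemma exists_hi {N : ℕ} (P : Fin N → ℕ) (u : Fin N) (x : Fin N) (hx : P u < P x) :
    ∃ hi, (∀ i, P i ≤ P hi) ∧ u ≠ hi := by
  obtain ⟨hi, -, h⟩ := Finset.exists_max_image Finset.univ P ⟨u, Finset.mem_univ _⟩
  refine ⟨hi, fun i => h i (Finset.mem_univ _), ?_⟩
  rintro rfl
  have := h x (Finset.mem_univ _)
  omega

/-- the list of points with the last one dropped -/
def dropLast {n : ℕ} (d : Fin n → ℕ) : Fin n → ℕ := fun i => if (i : ℕ) < n - 1 then d i else 0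

lemma dropLast_inj {n : ℕ} (d : Fin n → ℕ) (hpos : ∀ i, 0 < d i)
    (hinj : ∀ i j : Fin n, (i : ℕ) < n - 1 → (j : ℕ) < n - 1 → d i = d j → i = j) :
    Function.Injective (dropLast d) := by
  intro i j hij
  unfold dropLast at hij
  have h1 := hpos i
  have h2 := hpos j
  split_ifs at hij with q1 q2 q2
  · exact hinj i j q1 q2 hij
  · omega
  · omega
  · ext; omega

lemma extz_inj {n : ℕ} (d : Fin n → ℕ) (hpos : ∀ i, 0 < d i) (hinj : Function.Injective d) :
    Function.Injective (extz d) := by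
  intro i j hij
  unfold extz at hij
  split_ifs at hij with q1 q2 q2
  · have := congrArg Fin.val (hinj hij)
    ext; exact this
  · have := hpos ⟨i, q1⟩; omega
  · have := hpos ⟨j, q2⟩; omega
  · ext; omega

lemma dedup {n : ℕ} (hn : 4 ≤ n) (d : Fin n → ℕ) (hpos : ∀ i, 0 < d i)
    (hinj : ∀ i j : Fin n, (i : ℕ) < n - 1 → (j : ℕ) < n - 1 → d i = d j → i = j)
    (R : Fin (n - 1) → (Fin (n + 1) → ℕ) × (Fin (n + 1) → ℕ)) (hR : Gens (extz d) R)
    (j : Fin n) (hj : (j : ℕ) < n - 1) (hdj : d ⟨n - 1, by omega⟩ = d j) :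
    ∃ hi c M, (∀ i, dropLast d i ≤ dropLast d hi) ∧ KD (dropLast d) ⟨n - 1, by omega⟩ hi c M := by
  classical
  have hinj' := dropLast_inj d hpos hinj
  let f : Fin (n + 1) → Fin n := fun i => if h : (i : ℕ) < n - 1 then ⟨i, by omega⟩ else
    if (i : ℕ) = n - 1 then j else ⟨n - 1, by omega⟩
  let s : Fin n → Fin (n + 1) := fun i => if (i : ℕ) < n - 1 then ⟨i, by omega⟩ else ⟨n, by omega⟩
  obtain ⟨j₁, R', hR'⟩ := collapse hR (dropLast d) hinj' f s (by
      intro i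
      simp only [f, s]
      by_cases hi : (i : ℕ) < n - 1
      · simp [hi]
      · have h1 : ¬ (n < n - 1) := by omega
        have h2 : ¬ (n = n - 1) := by omega
        simp only [hi, if_false, h1, h2, dif_neg, not_false_eq_true]
        ext; simp; omega) (by
      intro i
      simp only [extz, f, dropLast]
      by_cases hi : (i : ℕ) < n - 1
      · have : (i : ℕ) < n := by omega
        simp [hi, this]
      · by_cases hi' : (i : ℕ) = n - 1
        · have : (i : ℕ) < n := by omega
          rw [dif_pos this, dif_neg hi, if_pos hi', if_pos hj, ← hdj]
          congr 1; ext; exact hi'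
        · have : ¬ (i : ℕ) < n := by omega
          rw [dif_neg this, dif_neg hi, if_neg hi', if_neg (by simp)])
    ⟨n - 1, by omega⟩ ⟨j, by omega⟩ (by
      intro h
      have := congrArg Fin.val h
      simp at this; omega) (by
      simp [f, hj])
  obtain ⟨hi, hhi, huhi⟩ := exists_hi (dropLast d) ⟨n - 1, by omega⟩ ⟨0, by omega⟩ (by
    have := hpos ⟨0, by omega⟩
    have h2 : 0 < n - 1 := by omega
    simp [dropLast, h2, this])
  obtain ⟨c, M, K⟩ := key hR' (by
    rw [Fintype.card_subtype_compl, Fintype.card_subtype_eq]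
    simp; omega) hinj' ⟨n - 1, by omega⟩ hi (by simp [dropLast]) hhi huhi
  exact ⟨hi, c, M, hhi, K⟩

lemma nodup {n : ℕ} (hn : 4 ≤ n) (d : Fin n → ℕ) (hpos : ∀ i, 0 < d i)
    (hinj : Function.Injective d)
    (R : Fin (n - 1) → (Fin (n + 1) → ℕ) × (Fin (n + 1) → ℕ)) (hR : Gens (extz d) R) :
    ∃ hi c M, (∀ i, extz d i ≤ extz d hi) ∧ KD (extz d) ⟨n, by omega⟩ hi c M := by
  obtain ⟨hi, hhi, huhi⟩ := exists_hi (extz d) ⟨n, by omega⟩ ⟨0, by omega⟩ (by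
    have := hpos ⟨0, by omega⟩
    have h2 : 0 < n := by omega
    simp [extz, h2, this])
  obtain ⟨c, M, K⟩ := key hR (by simp; omega) (extz_inj d hpos hinj) ⟨n, by omega⟩ hi
    (by simp [extz]) hhi huhi
  exact ⟨hi, c, M, hhi, K⟩

/-- arithmetic normal form of the necessity direction -/
lemma necessity (n : ℕ) (d : Fin n → ℕ) (hn : 4 ≤ n) (hpos : ∀ i, 0 < d i) (h e : ℕ)
    (hh : 0 < h) (he : 0 < e)
    (hform : ∀ i : Fin n, 0 < (i : ℕ) → (i : ℕ) < n - 1 → d i = h * d ⟨0, by omega⟩ + i * e)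
    (hy : d ⟨n - 1, by omega⟩ ≠ h * d ⟨0, by omega⟩)
    (R : Fin (n - 1) → (Fin (n + 1) → ℕ) × (Fin (n + 1) → ℕ)) (hR : Gens (extz d) R) :
    n = 4 ∧ h = 1 ∧
      ((∃ j : Fin n, (j : ℕ) < n - 1 ∧ d ⟨n - 1, by omega⟩ = d j ∧ Even (d ⟨0, by omega⟩)) ∨
       (∃ hi c M, (∀ i, extz d i ≤ extz d hi) ∧ KD (extz d) ⟨n, by omega⟩ hi c M ∧
        Function.Injective (extz d))) := by
  have hinj : ∀ i j : Fin n, (i : ℕ) < n - 1 → (j : ℕ) < n - 1 → d i = d j → i = j := by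
    have hlt : ∀ i j : Fin n, (i : ℕ) < j → (j : ℕ) < n - 1 → d i < d j := by
      intro i j hij hj
      rw [hform j (by omega) hj]
      have h0 := hpos ⟨0, by omega⟩
      have h3 : d ⟨0, by omega⟩ ≤ h * d ⟨0, by omega⟩ := Nat.le_mul_of_pos_left _ hh
      by_cases hi : (i : ℕ) = 0
      · have : i = ⟨0, by omega⟩ := by ext; exact hi
        rw [this]
        have : 0 < (j : ℕ) * e := Nat.mul_pos (by omega) he
        omega
      · rw [hform i (by omega) (by omega)]
        have := Nat.mul_lt_mul_of_pos_right hij he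
        omega
    intro i j hi hj hij
    rcases lt_trichotomy (i : ℕ) j with q | q | q
    · have := hlt i j q hj; omega
    · ext; exact q
    · have := hlt j i q hi; omega
  have h0 := hpos ⟨0, by omega⟩
  by_cases hdup : ∃ j : Fin n, (j : ℕ) < n - 1 ∧ d ⟨n - 1, by omega⟩ = d j
  · obtain ⟨j, hj, hdj⟩ := hdup
    obtain ⟨hi, c, M, hhi, K⟩ := dedup hn d hpos hinj R hR j hj hdj
    have hPinj := dropLast_inj d hpos hinj
    rcases Nat.lt_or_ge n 6 with hn6 | hn6
    · have : n = 4 ∨ n = 5 := by omega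
      rcases this with rfl | rfl
      · have f1 := hform 1 (by decide) (by decide)
        have f2 := hform 2 (by decide) (by decide)
        have hhi2 : hi = 2 := by
          have a2 := hhi 2
          have h3 : d 0 ≤ h * d 0 := Nat.le_mul_of_pos_left _ hh
          simp at f1 f2 h0
          rcases fin4 hi with rfl | rfl | rfl | rfl <;> simp [dropLast] at a2 ⊢ <;> omega
        subst hhi2
        obtain ⟨q1, q2⟩ := case4dup (P := dropLast d) K hPinj (d 0) h e h0 hh he (by simp [dropLast])
          (by simpa [dropLast] using f1) (by simpa [dropLast] using f2) (by simp [dropLast])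
        exact ⟨rfl, q1, Or.inl ⟨j, hj, hdj, q2⟩⟩
      · exfalso
        have f1 := hform 1 (by decide) (by decide)
        have f2 := hform 2 (by decide) (by decide)
        have f3 := hform 3 (by decide) (by decide)
        by_cases h1 : h = 1
        · subst h1
          refine K.quad hPinj (p := 0) (q := 1) (r := 2) (s := 3) (by decide) (by decide) (by decide)
            (by decide) ?_
          simp at f1 f2 f3
          simp [dropLast, f1, f2, f3]; omega
        · refine case4h (P := dropLast d) K hPinj hhi (d 0) h e h0 (by omega) he (by simp [dropLast])
            (by simpa [dropLast] using f1) (by simpa [dropLast] using f2) (by simp [dropLast]) ?_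
          simp at f3
          simp [dropLast, f3]; omega
    · exfalso
      refine K.quad hPinj (p := ⟨1, by omega⟩) (q := ⟨2, by omega⟩) (r := ⟨3, by omega⟩)
        (s := ⟨4, by omega⟩) (by simp) (by simp) (by simp) (by simp) ?_
      have f1 : dropLast d ⟨1, by omega⟩ = h * d ⟨0, by omega⟩ + 1 * e :=
        (if_pos (show 1 < n - 1 by omega)).trans (hform ⟨1, by omega⟩ (show 0 < 1 by omega) (show 1 < n - 1 by omega))
      have f2 : dropLast d ⟨2, by omega⟩ = h * d ⟨0, by omega⟩ + 2 * e :=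
        (if_pos (show 2 < n - 1 by omega)).trans (hform ⟨2, by omega⟩ (show 0 < 2 by omega) (show 2 < n - 1 by omega))
      have f3 : dropLast d ⟨3, by omega⟩ = h * d ⟨0, by omega⟩ + 3 * e :=
        (if_pos (show 3 < n - 1 by omega)).trans (hform ⟨3, by omega⟩ (show 0 < 3 by omega) (show 3 < n - 1 by omega))
      have f4 : dropLast d ⟨4, by omega⟩ = h * d ⟨0, by omega⟩ + 4 * e :=
        (if_pos (show 4 < n - 1 by omega)).trans (hform ⟨4, by omega⟩ (show 0 < 4 by omega) (show 4 < n - 1 by omega))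
      rw [f1, f2, f3, f4]
      ring
  · push Not at hdup
    have hinj' : Function.Injective d := by
      intro i j hij
      by_cases hi : (i : ℕ) < n - 1
      · by_cases hj : (j : ℕ) < n - 1
        · exact hinj i j hi hj hij
        · exfalso
          have : j = ⟨n - 1, by omega⟩ := by ext; simp; omega
          rw [this] at hij
          exact hdup i hi hij.symm
      · have hi' : i = ⟨n - 1, by omega⟩ := by ext; simp; omega
        by_cases hj : (j : ℕ) < n - 1
        · exfalso
          rw [hi'] at hij
          exact hdup j hj hij
        · ext; omega
    obtain ⟨hi, c, M, hhi, K⟩ := nodup hn d hpos hinj' R hR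
    have hPinj := extz_inj d hpos hinj'
    rcases Nat.lt_or_ge n 6 with hn6 | hn6
    · have : n = 4 ∨ n = 5 := by omega
      rcases this with rfl | rfl
      · have f1 := hform 1 (by decide) (by decide)
        have f2 := hform 2 (by decide) (by decide)
        by_cases h1 : h = 1
        · exact ⟨rfl, h1, Or.inr ⟨hi, c, M, hhi, K, hPinj⟩⟩
        · exfalso
          exact case4h (P := extz d) K hPinj hhi (d 0) h e h0 (by omega) he (by simp [extz])
            (by simpa [extz] using f1) (by simpa [extz] using f2) (by simp [extz])
            (by simpa [extz] using hy)
      · exfalso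
        have f1 := hform 1 (by decide) (by decide)
        have f2 := hform 2 (by decide) (by decide)
        have f3 := hform 3 (by decide) (by decide)
        by_cases h1 : h = 1
        · subst h1
          refine K.quad hPinj (p := 0) (q := 1) (r := 2) (s := 3) (by decide) (by decide) (by decide)
            (by decide) ?_
          simp at f1 f2 f3
          simp [extz, f1, f2, f3]; omega
        · exact case5h (P := extz d) K hPinj hhi (d 0) h e h0 (by omega) he (by simp [extz])
            (by simpa [extz] using f1) (by simpa [extz] using f2) (by simpa [extz] using f3)
            (by simp [extz])
    · exfalso
      refine K.quad hPinj (p := ⟨1, by omega⟩) (q := ⟨2, by omega⟩) (r := ⟨3, by omega⟩)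
        (s := ⟨4, by omega⟩) (by simp) (by simp) (by simp) (by simp) ?_
      have f1 : extz d ⟨1, by omega⟩ = h * d ⟨0, by omega⟩ + 1 * e :=
        (dif_pos (show 1 < n by omega)).trans (hform ⟨1, by omega⟩ (show 0 < 1 by omega) (show 1 < n - 1 by omega))
      have f2 : extz d ⟨2, by omega⟩ = h * d ⟨0, by omega⟩ + 2 * e :=
        (dif_pos (show 2 < n by omega)).trans (hform ⟨2, by omega⟩ (show 0 < 2 by omega) (show 2 < n - 1 by omega))
      have f3 : extz d ⟨3, by omega⟩ = h * d ⟨0, by omega⟩ + 3 * e :=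
        (dif_pos (show 3 < n by omega)).trans (hform ⟨3, by omega⟩ (show 0 < 3 by omega) (show 3 < n - 1 by omega))
      have f4 : extz d ⟨4, by omega⟩ = h * d ⟨0, by omega⟩ + 4 * e :=
        (dif_pos (show 4 < n by omega)).trans (hform ⟨4, by omega⟩ (show 0 < 4 by omega) (show 4 < n - 1 by omega))
      rw [f1, f2, f3, f4]
      ring

lemma extz3 (a b c : ℕ) : extz (![a, b, c] : Fin 3 → ℕ) = ![a, b, c, 0] := by
  ext i
  fin_cases i <;> rfl

lemma gcd4 (d : Fin 4 → ℕ) (e : ℕ) (h1 : d 1 = d 0 + e) (h2 : d 2 = d 0 + 2 * e)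
    (hgcd : Finset.univ.gcd d = 1) : Nat.gcd (Nat.gcd (d 0) (d 0 + e)) (d 3) = 1 := by
  apply Nat.dvd_one.1
  rw [← hgcd]
  set q := Nat.gcd (Nat.gcd (d 0) (d 0 + e)) (d 3)
  have q0 : q ∣ d 0 := (Nat.gcd_dvd_left _ _).trans (Nat.gcd_dvd_left _ _)
  have q1 : q ∣ d 0 + e := (Nat.gcd_dvd_left _ _).trans (Nat.gcd_dvd_right _ _)
  have qe : q ∣ e := (Nat.dvd_add_right q0).1 q1
  apply Finset.dvd_gcd
  intro i _
  rcases fin4 i with rfl | rfl | rfl | rfl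
  · exact q0
  · rw [h1]; exact q1
  · rw [h2]; exact dvd_add q0 (Dvd.dvd.mul_left qe _)
  · exact Nat.gcd_dvd_right _ _

end cases7

/-- Let `A = {d₁,…,dₙ}` with `n ≥ 4`, `{d₁,…,d_{n−1}}` a generalized
arithmetic sequence, `gcd(A) = 1`, and such that `{dₙ, d₂, …, d_{n−1}}` is not an
arithmetic sequence. Then `I_{A*}` is a complete intersection iff `n = 4`,
`{d₁, d₂, d₃}` is an arithmetic sequence, and either
(1) `d₁ / gcd(d₁,d₂)` is even and `gcd(d₁,d₂)·d₄ = β₁d₁ + β₂d₂ + β₃d₃` with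
`β₁ + β₂ + β₃ ≤ gcd(d₁,d₂)`, or
(2) `d₁, d₄` are even and `I_{C*}` is a complete intersection for
`C = {d₁, d₃, d₄}`. -/
theorem stmt7 (k : Type*) [Field k] (n : ℕ) (d : Fin n → ℕ)
    (hn : 4 ≤ n) (hpos : ∀ i, 0 < d i)
    (hga : IsGenArith (fun j : Fin (n - 1) => d (j.castLE (by omega))))
    (hgcd : Finset.univ.gcd d = 1)
    (hnotarith : ¬ IsArithFn (fun j : Fin (n - 1) =>
      if (j : ℕ) = 0 then d ⟨n - 1, by omega⟩ else d (j.castLE (by omega)))) :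
    ProjIsCI k d ↔ n = 4 ∧
      IsArithFn (fun j : Fin 3 => d (j.castLE (by omega))) ∧
      ((Even (d ⟨0, by omega⟩ / Nat.gcd (d ⟨0, by omega⟩) (d ⟨1, by omega⟩)) ∧
          ∃ β₁ β₂ β₃ : ℕ,
            Nat.gcd (d ⟨0, by omega⟩) (d ⟨1, by omega⟩) * d ⟨3, by omega⟩ =
                β₁ * d ⟨0, by omega⟩ + β₂ * d ⟨1, by omega⟩ + β₃ * d ⟨2, by omega⟩ ∧
              β₁ + β₂ + β₃ ≤ Nat.gcd (d ⟨0, by omega⟩) (d ⟨1, by omega⟩)) ∨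
        (Even (d ⟨0, by omega⟩) ∧ Even (d ⟨3, by omega⟩) ∧
          ProjIsCI k (![d ⟨0, by omega⟩, d ⟨2, by omega⟩, d ⟨3, by omega⟩] : Fin 3 → ℕ))) := by
  have hD : 0 < Finset.univ.sup d :=
    lt_of_lt_of_le (hpos ⟨0, by omega⟩) (Finset.le_sup (Finset.mem_univ _))
  obtain ⟨h, e, hh, he, hform0⟩ := hga
  have hform : ∀ i : Fin n, 0 < (i : ℕ) → (i : ℕ) < n - 1 →
      d i = h * d ⟨0, by omega⟩ + i * e := by
    intro i hi hi'
    have := hform0 ⟨i, hi'⟩ hi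
    simpa using this
  have hy : d ⟨n - 1, by omega⟩ ≠ h * d ⟨0, by omega⟩ := by
    intro hy
    apply hnotarith
    refine ⟨e, he, ?_⟩
    intro i hi
    have h1 : ¬ ((i : ℕ) = 0) := by omega
    have := hform0 i hi
    simp only [h1, if_false, if_true]
    rw [hy]
    exact this
  constructor
  · intro hCI
    obtain ⟨R, hR⟩ := (projCI_iff k d hD).1 hCI
    obtain ⟨rfl, rfl, hcase⟩ := necessity n d hn hpos h e hh he hform hy R hR
    have f1 : d 1 = d 0 + e := by
      have := hform 1 (by decide) (by decide)
      simpa using this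
    have f2 : d 2 = d 0 + 2 * e := by
      have := hform 2 (by decide) (by decide)
      simpa using this
    have hg := gcd4 d e f1 f2 hgcd
    refine ⟨rfl, ⟨e, he, ?_⟩, ?_⟩
    · intro i hi
      have : i = 1 ∨ i = 2 := by revert i; decide
      rcases this with rfl | rfl
      · simpa using f1
      · simpa using f2
    · change (Even (d 0 / Nat.gcd (d 0) (d 1)) ∧ ∃ β₁ β₂ β₃ : ℕ, Nat.gcd (d 0) (d 1) * d 3 =
          β₁ * d 0 + β₂ * d 1 + β₃ * d 2 ∧ β₁ + β₂ + β₃ ≤ Nat.gcd (d 0) (d 1)) ∨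
        (Even (d 0) ∧ Even (d 3) ∧ ProjIsCI k ![d 0, d 2, d 3])
      rw [f1, f2]
      rcases hcase with ⟨j, hj, hdj, hev⟩ | ⟨hi, c, M, hhi, K, hinj⟩
      · left
        replace hdj : d 3 = d j := hdj
        replace hev : Even (d 0) := hev
        set g := Nat.gcd (d 0) (d 0 + e) with hgdef
        have g0 : g ∣ d 0 := Nat.gcd_dvd_left _ _
        have g1 : g ∣ d 0 + e := Nat.gcd_dvd_right _ _
        have ge : g ∣ e := (Nat.dvd_add_right g0).1 g1
        have hj' : j = 0 ∨ j = 1 ∨ j = 2 := by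
          rcases fin4 j with rfl | rfl | rfl | rfl
          · simp
          · simp
          · simp
          · exact absurd hj (by decide)
        have gj : g ∣ d 3 := by
          rw [hdj]
          rcases hj' with rfl | rfl | rfl
          · exact g0
          · rw [f1]; exact g1
          · rw [f2]; exact dvd_add g0 (Dvd.dvd.mul_left ge _)
        have hg1 : g = 1 := by
          rw [Nat.gcd_eq_left gj] at hg; exact hg
        rw [hg1]
        refine ⟨by simpa using hev, ?_⟩
        rcases hj' with rfl | rfl | rfl
        · exact ⟨1, 0, 0, by omega, by omega⟩
        · exact ⟨0, 1, 0, by omega, by omega⟩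
        · exact ⟨0, 0, 1, by omega, by omega⟩
      · rcases case4one (P := extz d) K hinj hhi (d 0) e (hpos 0) he (by simp [extz])
          (by simpa [extz] using f1) (by simpa [extz] using f2) (by simp [extz])
          (by simpa [extz] using hg) with q | ⟨q1, q2, q3⟩
        · left
          exact q
        · right
          refine ⟨q1, q2, ?_⟩
          rw [projCI_iff k _ (lt_of_lt_of_le (hpos 0)
            (Finset.le_sup (f := ![d 0, d 0 + 2 * e, d 3]) (Finset.mem_univ 0))), extz3]
          exact q3
  · rintro ⟨rfl, ⟨e', he', harith⟩, hcase⟩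
    have f1 : d 1 = d 0 + e' := by
      have := harith 1 (by decide)
      simpa using this
    have f2 : d 2 = d 0 + 2 * e' := by
      have := harith 2 (by decide)
      simpa using this
    have hg := gcd4 d e' f1 f2 hgcd
    change (Even (d 0 / Nat.gcd (d 0) (d 1)) ∧ ∃ β₁ β₂ β₃ : ℕ, Nat.gcd (d 0) (d 1) * d 3 =
          β₁ * d 0 + β₂ * d 1 + β₃ * d 2 ∧ β₁ + β₂ + β₃ ≤ Nat.gcd (d 0) (d 1)) ∨
        (Even (d 0) ∧ Even (d 3) ∧ ProjIsCI k ![d 0, d 2, d 3]) at hcase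
    rw [f1, f2] at hcase
    rw [projCI_iff k d hD]
    rcases hcase with ⟨hev, β₁, β₂, β₃, q1, q2⟩ | ⟨q1, q2, q3⟩
    · exact suff1 (P := extz d) (d 0) e' (hpos 0) he' (by simp [extz])
        (by simpa [extz] using f1) (by simpa [extz] using f2) (by simp [extz])
        (by simpa [extz] using hg) hev β₁ β₂ β₃ q1 q2
    · rw [projCI_iff k _ (lt_of_lt_of_le (hpos 0)
            (Finset.le_sup (f := ![d 0, d 0 + 2 * e', d 3]) (Finset.mem_univ 0))), extz3] at q3
      obtain ⟨R', hR'⟩ := q3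
      exact suff2 (P := extz d) (d 0) e' (by simp [extz])
        (by simpa [extz] using f1) (by simpa [extz] using f2) (by simp [extz])
        (by simpa [extz] using hg) q1 q2 R' hR'
end

section
/- Let A = {d_1, …, d_n} be a set of n distinct positive integers. Suppose there exist indices 1 ≤ i < j ≤ n such that m_i·d_i ≠ m_j·d_j and there are α_1, …, α_n, β_1, …, β_n ∈ ℕ with m_i·d_i = Σ_{k≠i} α_k d_k, m_j·d_j = Σ_{k≠j} β_k d_k, α_j ≠ 0 and β_i ≠ 0. Then the toric ideal I_A is not a complete intersection. -/
open MvPolynomial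

namespace ToricAux

noncomputable def chainHom (k : Type*) [Field k] (n r : ℕ) :
    MvPolynomial (Fin n) k →ₐ[k] MvPolynomial (Fin n) k :=
  MvPolynomial.aeval (fun s : Fin n => if (s : ℕ) < r then 0 else X s)

noncomputable def chainIdeal (k : Type*) [Field k] (n r : ℕ) : Ideal (MvPolynomial (Fin n) k) :=
  RingHom.ker (chainHom k n r).toRingHom

theorem mem_chainIdeal {k : Type*} [Field k] {n r : ℕ} {f : MvPolynomial (Fin n) k} :
    f ∈ chainIdeal k n r ↔ chainHom k n r f = 0 := Iff.rfl

instance chainIdeal_isPrime (k : Type*) [Field k] (n r : ℕ) : (chainIdeal k n r).IsPrime :=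
  RingHom.ker_isPrime _

theorem chainIdeal_lt {k : Type*} [Field k] {n r : ℕ} (hr : r < n) :
    chainIdeal k n r < chainIdeal k n (r + 1) := by
  rw [SetLike.lt_iff_le_and_exists]
  constructor
  · intro f hf
    rw [mem_chainIdeal] at hf ⊢
    have : (chainHom k n (r+1)) = (chainHom k n (r+1)).comp (chainHom k n r) := by
      apply MvPolynomial.algHom_ext
      intro s
      simp only [chainHom, AlgHom.comp_apply, aeval_X]
      by_cases h : (s : ℕ) < r
      · simp [h, Nat.lt_succ_of_lt h]
      · simp [h]
    rw [this, AlgHom.comp_apply, hf, map_zero]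
  · refine ⟨X ⟨r, hr⟩, ?_, ?_⟩
    · rw [mem_chainIdeal]; simp [chainHom]
    · rw [mem_chainIdeal]; simp [chainHom]

theorem le_height {k : Type*} [Field k] {n : ℕ} (r : ℕ) (hr : r ≤ n) :
    (r : ℕ∞) ≤ (chainIdeal k n r).height := by
  induction r with
  | zero => simp
  | succ r ih =>
    have h1 := Ideal.height_add_one_le_of_lt_of_isPrime (chainIdeal_lt (k := k) (Nat.lt_of_succ_le hr))
    refine le_trans ?_ h1
    push_cast
    gcongr
    exact ih (by omega)

theorem mem_top {k : Type*} [Field k] {n : ℕ} {f : MvPolynomial (Fin n) k} :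
    f ∈ chainIdeal k n n ↔ constantCoeff f = 0 := by
  rw [mem_chainIdeal]
  have : chainHom k n n f = C (constantCoeff f) := by
    have h : (fun s : Fin n => if (s : ℕ) < n then (0 : MvPolynomial (Fin n) k) else X s) = 0 := by
      ext1 s; simp
    rw [chainHom, h, MvPolynomial.aeval_zero]; rfl
  rw [this, C_eq_zero]

theorem top_le {k : Type*} [Field k] {n : ℕ} (p : Ideal (MvPolynomial (Fin n) k))
    (h : ∀ s, X s ∈ p) : chainIdeal k n n ≤ p := by
  intro f hf
  rw [mem_top] at hf
  have key : ∀ f : MvPolynomial (Fin n) k, f - C (constantCoeff f) ∈ p := by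
    intro f
    induction f using MvPolynomial.induction_on with
    | C a => simp
    | add a b ha hb =>
      have := p.add_mem ha hb
      rw [map_add, C_add]; convert this using 1; ring
    | mul_X a s _ => simpa using p.mul_mem_left a (h s)
  simpa [hf] using key f

variable {k : Type*} [Field k] {n : ℕ} {d : Fin n → ℕ}

theorem aeval_eq (g : MvPolynomial (Fin n) k) :
    MvPolynomial.aeval (fun i : Fin n => (Polynomial.X : Polynomial k) ^ d i) g
      = ∑ u ∈ g.support, Polynomial.monomial (∑ s, u s * d s) (coeff u g) := by
  conv_lhs => rw [MvPolynomial.aeval_def, MvPolynomial.eval₂_eq']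
  apply Finset.sum_congr rfl
  intro u _
  rw [← Polynomial.C_mul_X_pow_eq_monomial, ← Finset.prod_pow_eq_pow_sum]
  congr 1
  apply Finset.prod_congr rfl
  intro s _
  rw [← pow_mul, mul_comm]

theorem mem_toric (g : MvPolynomial (Fin n) k) : g ∈ toricIdeal k d ↔
    MvPolynomial.aeval (fun i : Fin n => (Polynomial.X : Polynomial k) ^ d i) g = 0 := Iff.rfl

theorem binom_mem (u v : Fin n →₀ ℕ) (h : ∑ s, u s * d s = ∑ s, v s * d s) :
    monomial u (1 : k) - monomial v 1 ∈ toricIdeal k d := by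
  have key : ∀ u : Fin n →₀ ℕ,
      MvPolynomial.aeval (fun i : Fin n => (Polynomial.X : Polynomial k) ^ d i) (monomial u (1 : k))
        = Polynomial.X ^ (∑ s, u s * d s) := by
    intro u
    rw [aeval_eq]
    classical
    rw [support_monomial, if_neg one_ne_zero, Finset.sum_singleton, coeff_monomial, if_pos rfl,
      Polynomial.monomial_one_right_eq_X_pow]
  rw [mem_toric, map_sub, key, key, h, sub_self]

theorem unique_rep (hpos : ∀ i, 0 < d i) {i : Fin n} {mi : ℕ}
    (hm : IsLeast {b : ℕ | 0 < b ∧ ∃ α : Fin n → ℕ, α i = 0 ∧ b * d i = ∑ s, α s * d s} mi)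
    {b : ℕ} (hb : b < mi) (u : Fin n →₀ ℕ) (hu : ∑ s, u s * d s = b * d i) :
    u = Finsupp.single i b := by
  classical
  have hsplit : ∑ s, u s * d s = u i * d i + ∑ s ∈ Finset.univ.erase i, u s * d s :=
    (Finset.add_sum_erase _ _ (Finset.mem_univ i)).symm
  rcases lt_or_ge (u i) b with h | h
  · exfalso
    have : b - u i ∈ {b : ℕ | 0 < b ∧ ∃ α : Fin n → ℕ, α i = 0 ∧ b * d i = ∑ s, α s * d s} := by
      refine ⟨by omega, Function.update u i 0, by simp, ?_⟩
      rw [← Finset.add_sum_erase _ _ (Finset.mem_univ i)]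
      have : ∑ s ∈ Finset.univ.erase i, Function.update u i 0 s * d s
          = ∑ s ∈ Finset.univ.erase i, u s * d s := by
        apply Finset.sum_congr rfl
        intro s hs
        rw [Function.update_of_ne (Finset.ne_of_mem_erase hs)]
      rw [this, Nat.sub_mul]
      simp
      omega
    have := hm.2 this
    omega
  · have h1 : b * d i ≤ u i * d i := Nat.mul_le_mul_right _ h
    have h2 : ∑ s ∈ Finset.univ.erase i, u s * d s = 0 := by omega
    have h3 : u i = b := Nat.eq_of_mul_eq_mul_right (hpos i) (by omega)
    ext s
    by_cases hs : s = i
    · subst hs; simp [h3]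
    · rw [Finsupp.single_eq_of_ne hs]
      have := Finset.sum_eq_zero_iff.1 h2 s (by simp [hs])
      rcases Nat.mul_eq_zero.1 this with h | h
      · exact h
      · exact absurd h (hpos s).ne'

theorem coeff_zero_of_mem (hpos : ∀ i, 0 < d i) {i : Fin n} {mi : ℕ}
    (hm : IsLeast {b : ℕ | 0 < b ∧ ∃ α : Fin n → ℕ, α i = 0 ∧ b * d i = ∑ s, α s * d s} mi)
    {b : ℕ} (hb : b < mi) {g : MvPolynomial (Fin n) k} (hg : g ∈ toricIdeal k d) :
    coeff (Finsupp.single i b) g = 0 := by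
  classical
  rw [mem_toric, aeval_eq] at hg
  have h := congrArg (fun p => Polynomial.coeff p (b * d i)) hg
  simp only [Polynomial.finsetSum_coeff, Polynomial.coeff_monomial, Polynomial.coeff_zero] at h
  rw [Finset.sum_eq_single (Finsupp.single i b)] at h
  · rw [if_pos] at h
    · exact h
    · rw [Finset.sum_eq_single i] <;> simp +contextual [Finsupp.single_apply, eq_comm]
  · intro u _ hu
    rw [if_neg]
    intro h'
    exact hu (unique_rep hpos hm hb u h')
  · intro h'
    simp [notMem_support_iff.1 h']

theorem coeff_mul_of_mem (hpos : ∀ i, 0 < d i) {i : Fin n} {mi : ℕ}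
    (hm : IsLeast {b : ℕ | 0 < b ∧ ∃ α : Fin n → ℕ, α i = 0 ∧ b * d i = ∑ s, α s * d s} mi)
    (c : MvPolynomial (Fin n) k) {g : MvPolynomial (Fin n) k} (hg : g ∈ toricIdeal k d) :
    coeff (Finsupp.single i mi) (c * g) = constantCoeff c * coeff (Finsupp.single i mi) g := by
  classical
  rw [coeff_mul, Finset.sum_eq_single (0, Finsupp.single i mi)]
  · simp [constantCoeff_eq]
  · rintro ⟨p, q⟩ hpq hne
    rw [Finset.HasAntidiagonal.mem_antidiagonal] at hpq
    have hq : q = Finsupp.single i (q i) := by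
      ext s
      by_cases hs : s = i
      · subst hs; simp
      · have := DFunLike.congr_fun hpq s
        simp only [Finsupp.add_apply, Finsupp.single_eq_of_ne hs] at this ⊢
        omega
    have hp := DFunLike.congr_fun hpq i
    simp only [Finsupp.add_apply, Finsupp.single_eq_same] at hp
    rcases lt_or_ge (q i) mi with h | h
    · rw [hq]
      simp only [coeff_zero_of_mem hpos hm h hg, mul_zero]
    · exfalso
      apply hne
      have hqi : q i = mi := by omega
      rw [hqi] at hq
      have hp0 : p = 0 := by
        rw [hq] at hpq
        simpa using hpq
      rw [hp0, hq]
  · intro h; simp at h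

end ToricAux

open ToricAux

/-- Let `A = {d₁,…,dₙ}` be a set of `n` distinct positive integers
and, for each `i`, let `m i` be the least positive integer `b` with
`b·d_i ∈ Σ_{j≠i} ℕ·d_j`. If there are indices `i < j` with `m_i·d_i ≠ m_j·d_j`,
and expressions `m_i·d_i = Σ_{k≠i} α_k d_k`, `m_j·d_j = Σ_{k≠j} β_k d_k` with
`α_j ≠ 0` and `β_i ≠ 0`, then `I_A` is not a complete intersection. -/
theorem stmt10 (k : Type*) [Field k] (n : ℕ) (d : Fin n → ℕ)
    (hpos : ∀ i, 0 < d i) (hinj : Function.Injective d)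
    (m : Fin n → ℕ)
    (hm : ∀ i : Fin n, IsLeast
      {b : ℕ | 0 < b ∧ ∃ α : Fin n → ℕ, α i = 0 ∧ b * d i = ∑ s, α s * d s} (m i))
    (i j : Fin n) (hij : i < j)
    (hne : m i * d i ≠ m j * d j)
    (α β : Fin n → ℕ) (hαi0 : α i = 0) (hβj0 : β j = 0)
    (hα : m i * d i = ∑ s, α s * d s) (hβ : m j * d j = ∑ s, β s * d s)
    (hαj : α j ≠ 0) (hβi : β i ≠ 0) :
    ¬ IsCI k d := by
  classical
  rintro ⟨g, hg⟩
  have hgI : ∀ r, g r ∈ toricIdeal k d := fun r => hg ▸ Ideal.subset_span ⟨r, rfl⟩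
  have hmi := (hm i).1.1
  have hmj := (hm j).1.1
  have hji : j ≠ i := hij.ne'
  set M := chainIdeal k n n with hM
  set ui : Fin n →₀ ℕ := Finsupp.single i (m i) with hui
  set uj : Fin n →₀ ℕ := Finsupp.single j (m j) with huj
  set a : Fin n →₀ ℕ := Finsupp.equivFunOnFinite.symm α with ha
  set b : Fin n →₀ ℕ := Finsupp.equivFunOnFinite.symm β with hb
  have hdeg : ∀ (s : Fin n) (c : ℕ), ∑ t, (Finsupp.single s c : Fin n →₀ ℕ) t * d t = c * d s := by
    intro s c
    rw [Finset.sum_eq_single s] <;> simp +contextual [Finsupp.single_apply, eq_comm]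
  have da : ∑ t, a t * d t = m i * d i := hα.symm
  have db : ∑ t, b t * d t = m j * d j := hβ.symm
  set fi : MvPolynomial (Fin n) k := monomial ui 1 - monomial a 1 with hfi
  set fj : MvPolynomial (Fin n) k := monomial uj 1 - monomial b 1 with hfj
  have hfiI : fi ∈ toricIdeal k d := binom_mem _ _ (by rw [hdeg, da])
  have hfjI : fj ∈ toricIdeal k d := binom_mem _ _ (by rw [hdeg, db])
  have e1 : a ≠ ui := by
    intro h
    have := DFunLike.congr_fun h i
    simp [ha, hui, hαi0] at this
    omega
  have e2 : b ≠ uj := by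
    intro h
    have := DFunLike.congr_fun h j
    simp [hb, huj, hβj0] at this
    omega
  have hdne : ∀ u v : Fin n →₀ ℕ, ∑ t, u t * d t ≠ ∑ t, v t * d t → u ≠ v := by
    rintro u v h rfl; exact h rfl
  have lii : coeff ui fi = 1 := by simp [hfi, coeff_monomial, e1]
  have ljj : coeff uj fj = 1 := by simp [hfj, coeff_monomial, e2]
  have lij : coeff ui fj = 0 := by
    have h1 : uj ≠ ui := hdne _ _ (by rw [hdeg, hdeg]; exact hne.symm)
    have h2 : b ≠ ui := hdne _ _ (by rw [hdeg, db]; exact hne.symm)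
    simp [hfj, coeff_monomial, h1, h2]
  have lji : coeff uj fi = 0 := by
    have h1 : ui ≠ uj := hdne _ _ (by rw [hdeg, hdeg]; exact hne)
    have h2 : a ≠ uj := hdne _ _ (by rw [hdeg, da]; exact hne)
    simp [hfi, coeff_monomial, h1, h2]
  -- the linear maps
  let L : (Fin (n-1) → k) →ₗ[k] MvPolynomial (Fin n) k := Fintype.linearCombination k g
  have hL : ∀ c, L c = ∑ r, C (c r) * g r := by
    intro c
    simp [L, Fintype.linearCombination_apply, MvPolynomial.smul_eq_C_mul]
  have hLI : ∀ c, L c ∈ toricIdeal k d := by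
    intro c; rw [hL]; exact Ideal.sum_mem _ (fun r _ => Ideal.mul_mem_left _ _ (hgI r))
  let Λ : (Fin (n-1) → k) →ₗ[k] k × k :=
    ((MvPolynomial.lcoeff k ui).prod (MvPolynomial.lcoeff k uj)).comp L
  have hΛ : ∀ c, Λ c = (coeff ui (L c), coeff uj (L c)) := fun c => rfl
  have hred : ∀ f ∈ toricIdeal k d, ∃ c, f - L c ∈ M • toricIdeal k d ∧
      Λ c = (coeff ui f, coeff uj f) := by
    intro f hf
    have hf' := hf
    rw [← hg] at hf'
    obtain ⟨c, hc⟩ := (Ideal.mem_span_range_iff_exists_fun).1 hf'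
    refine ⟨fun r => constantCoeff (c r), ?_, ?_⟩
    · rw [hL, ← hc, ← Finset.sum_sub_distrib]
      refine Submodule.sum_mem _ (fun r _ => ?_)
      rw [← sub_mul]
      exact Submodule.smul_mem_smul (mem_top.2 (by simp)) (hgI r)
    · rw [hΛ, hL, ← hc]
      simp only [coeff_sum, coeff_C_mul, hui, huj]
      simp only [coeff_mul_of_mem hpos (hm i) _ (hgI _), coeff_mul_of_mem hpos (hm j) _ (hgI _)]
  obtain ⟨ci, hci, hci'⟩ := hred fi hfiI
  obtain ⟨cj, hcj, hcj'⟩ := hred fj hfjI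
  rw [lii, lji] at hci'
  rw [lij, ljj] at hcj'
  have hsurj : Function.Surjective Λ := by
    rintro ⟨x, y⟩
    refine ⟨x • ci + y • cj, ?_⟩
    rw [map_add, map_smul, map_smul, hci', hcj']
    simp
  have hfin : Module.finrank k (LinearMap.ker Λ) + 2 = n - 1 := by
    have h1 := LinearMap.finrank_range_add_finrank_ker Λ
    rw [LinearMap.range_eq_top.2 hsurj, finrank_top] at h1
    simp at h1
    omega
  let w := Module.finBasis k (LinearMap.ker Λ)
  let h : Fin (Module.finrank k (LinearMap.ker Λ)) → MvPolynomial (Fin n) k := fun q => L (w q)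
  let T : Finset (MvPolynomial (Fin n) k) := {X i, X j} ∪ Finset.univ.image h
  have hT : T.card ≤ n - 1 := by
    refine (Finset.card_union_le _ _).trans ?_
    have h1 : ({X i, X j} : Finset (MvPolynomial (Fin n) k)).card ≤ 2 := Finset.card_le_two
    have h2 : (Finset.univ.image h).card ≤ _ := Finset.card_image_le
    simp only [Finset.card_univ, Fintype.card_fin] at h2
    omega
  set J : Ideal (MvPolynomial (Fin n) k) := Ideal.span (T : Set (MvPolynomial (Fin n) k)) with hJ
  have hXi : (X i : MvPolynomial (Fin n) k) ∈ J := Ideal.subset_span (by simp [T])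
  have hXj : (X j : MvPolynomial (Fin n) k) ∈ J := Ideal.subset_span (by simp [T])
  have hmon : ∀ (u : Fin n →₀ ℕ) (s : Fin n), u s ≠ 0 → (X s : MvPolynomial (Fin n) k) ∈ J →
      (monomial u (1 : k)) ∈ J := by
    intro u s hs hX
    refine Ideal.mem_of_dvd _ ?_ hX
    rw [MvPolynomial.X_dvd_monomial]
    exact Or.inr hs
  have hfiJ : fi ∈ J := J.sub_mem (hmon ui i (by simp [hui]; omega) hXi) (hmon a j hαj hXj)
  have hfjJ : fj ∈ J := J.sub_mem (hmon uj j (by simp [huj]; omega) hXj) (hmon b i hβi hXi)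
  have hker : ∀ c ∈ LinearMap.ker Λ, L c ∈ J := by
    intro c hc
    have h1 := w.sum_repr ⟨c, hc⟩
    have h2 := congrArg (fun z : LinearMap.ker Λ => L z) h1
    simp only [Submodule.coe_sum, Submodule.coe_smul, map_sum, map_smul] at h2
    rw [← h2]
    refine Ideal.sum_mem _ (fun q _ => ?_)
    rw [MvPolynomial.smul_eq_C_mul]
    refine Ideal.mul_mem_left _ _ (Ideal.subset_span ?_)
    simp only [T, Finset.coe_union, Finset.coe_image, Finset.coe_univ, Set.image_univ]
    exact Or.inr ⟨q, rfl⟩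
  have hIJ : toricIdeal k d ≤ J ⊔ M • toricIdeal k d := by
    have hL0 : ∀ f c, f ∈ J → f - L c ∈ M • toricIdeal k d →
        L c ∈ J ⊔ M • toricIdeal k d := by
      intro f c hf hc
      have : L c = f - (f - L c) := by ring
      rw [this]
      exact Submodule.sub_mem _ (Submodule.mem_sup_left hf) (Submodule.mem_sup_right hc)
    intro f hf
    obtain ⟨c, hc, hc'⟩ := hred f hf
    set x := coeff ui f
    set y := coeff uj f
    have hw : c - x • ci - y • cj ∈ LinearMap.ker Λ := by
      rw [LinearMap.mem_ker, map_sub, map_sub, map_smul, map_smul, hci', hcj', hc']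
      simp
    have hw' := hker _ hw
    rw [map_sub, map_sub, map_smul, map_smul, MvPolynomial.smul_eq_C_mul,
      MvPolynomial.smul_eq_C_mul] at hw'
    have hdec : f = (f - L c) + ((L c - C x * L ci - C y * L cj) + C x * L ci + C y * L cj) := by
      ring
    rw [hdec]
    refine Submodule.add_mem _ (Submodule.mem_sup_right hc) (Submodule.add_mem _ (Submodule.add_mem _
      (Submodule.mem_sup_left hw') ?_) ?_)
    · exact Ideal.mul_mem_left _ _ (hL0 fi ci hfiJ hci)
    · exact Ideal.mul_mem_left _ _ (hL0 fj cj hfjJ hcj)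
  obtain ⟨r, hr1, hr2⟩ := Submodule.exists_sub_one_mem_and_smul_le_of_fg_of_le_sup
    (IsNoetherian.noetherian (toricIdeal k d)) le_rfl hIJ
  have hIM : toricIdeal k d ≤ M := by
    intro f hf
    rw [mem_top, constantCoeff_eq]
    simpa using coeff_zero_of_mem hpos (hm i) hmi hf
  have hXM : ∀ s, (X s : MvPolynomial (Fin n) k) ∈ M := fun s => mem_top.2 (by simp)
  have hJM : J ≤ M := by
    rw [hJ, Ideal.span_le]
    intro f hf
    simp only [T, Finset.coe_union, Finset.coe_image, Finset.coe_univ, Set.image_univ,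
      Finset.coe_insert, Finset.coe_singleton] at hf
    rcases hf with (rfl | rfl) | ⟨q, rfl⟩
    · exact hXM i
    · exact hXM j
    · exact hIM (hLI _)
  have hmin : M ∈ J.minimalPrimes := by
    refine ⟨⟨chainIdeal_isPrime k n n, hJM⟩, ?_⟩
    rintro p ⟨hp, hJp⟩ hpM
    have hrp : r ∉ p := by
      intro hrp
      have h1 : (1 : MvPolynomial (Fin n) k) ∈ M := by
        have := M.sub_mem (hpM hrp) hr1
        simpa using this
      exact (chainIdeal_isPrime k n n).ne_top ((Ideal.eq_top_iff_one _).2 h1)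
    have hIp : toricIdeal k d ≤ p := by
      intro f hf
      have h1 : r * f ∈ p := hJp (hr2 (Submodule.smul_mem_pointwise_smul f r _ hf))
      exact (hp.mem_or_mem h1).resolve_left hrp
    apply top_le
    intro s
    have h1 : monomial (Finsupp.single s (d i)) (1 : k) - monomial (Finsupp.single i (d s)) 1
        ∈ toricIdeal k d := binom_mem _ _ (by rw [hdeg, hdeg, mul_comm])
    have h2 : monomial (Finsupp.single i (d s)) (1 : k) ∈ p :=
      hJp (hmon _ i (by simpa using (hpos s).ne') hXi)
    have h3 := p.add_mem (hIp h1) h2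
    rw [sub_add_cancel, ← MvPolynomial.X_pow_eq_monomial] at h3
    exact hp.mem_of_pow_mem _ h3
  have hh1 := Ideal.height_le_card_of_mem_minimalPrimes_span_finset hmin
  have hh2 := (le_height (k := k) n le_rfl).trans hh1
  have hh3 : n ≤ T.card := by exact_mod_cast hh2
  omega
end

section
/- Let A = {d_1, …, d_n} be a set of positive integers with n ≥ 4, gcd(d_1, …, d_n) = 1, such that A minimally generates the numerical semigroup ℕd_1 + … + ℕd_n. If some four elements of A form a generalized arithmetic sequence, then the toric ideal I_A is not a complete intersection. -/
open MvPolynomial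

/-- The parametrisation map. -/
noncomputable def phiM (k : Type*) [Field k] {n : ℕ} (d : Fin n → ℕ) :
    MvPolynomial (Fin n) k →ₐ[k] Polynomial k :=
  MvPolynomial.aeval (fun i : Fin n => (Polynomial.X : Polynomial k) ^ d i)

theorem mem_toric {k : Type*} [Field k] {n : ℕ} {d : Fin n → ℕ} {f : MvPolynomial (Fin n) k} :
    f ∈ toricIdeal k d ↔ phiM k d f = 0 := Iff.rfl

theorem phiM_X {k : Type*} [Field k] {n : ℕ} (d : Fin n → ℕ) (i : Fin n) :
    phiM k d (X i) = Polynomial.X ^ d i := by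
  simp [phiM]

theorem phiM_eval_zero {k : Type*} [Field k] {n : ℕ} {d : Fin n → ℕ} (hpos : ∀ i, 0 < d i)
    (f : MvPolynomial (Fin n) k) :
    Polynomial.eval 0 (phiM k d f) = constantCoeff f := by
  induction f using MvPolynomial.induction_on with
  | C a => simp [phiM]
  | add p q hp hq => simp [hp, hq]
  | mul_X p i hp => simp [phiM_X, (hpos i).ne']

theorem weight_eq {n : ℕ} {d : Fin n → ℕ} (hpos : ∀ i, 0 < d i) (hmin : MinimallyGenerates d)
    (p : Fin n) (u : Fin n →₀ ℕ) (hu : ∑ i, d i * u i = d p) : u = Finsupp.single p 1 := by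
  by_cases h0 : u p = 0
  · exact absurd ⟨u, h0, by rw [← hu]; exact Finset.sum_congr rfl fun _ _ => mul_comm _ _⟩ (hmin p)
  · rw [← Finset.add_sum_erase _ _ (Finset.mem_univ p)] at hu
    have h1 : d p ≤ d p * u p := Nat.le_mul_of_pos_right _ (Nat.pos_of_ne_zero h0)
    have h2 : ∑ i ∈ Finset.univ.erase p, d i * u i = 0 := by omega
    have h3 : d p * u p = d p * 1 := by omega
    have h4 := Nat.eq_of_mul_eq_mul_left (hpos p) h3
    rw [Finset.sum_eq_zero_iff] at h2
    ext i
    by_cases hi : i = p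
    · subst hi; simp [h4]
    · have := h2 i (by simp [hi])
      have h5 := hpos i
      rw [Finsupp.single_eq_of_ne hi]
      rcases Nat.mul_eq_zero.1 this with h | h
      · omega
      · exact h

theorem coeff_single_zero {k : Type*} [Field k] {n : ℕ} {d : Fin n → ℕ} (hpos : ∀ i, 0 < d i)
    (hmin : MinimallyGenerates d) {f : MvPolynomial (Fin n) k} (hf : f ∈ toricIdeal k d)
    (p : Fin n) : coeff (Finsupp.single p 1) f = 0 := by
  rw [mem_toric, phiM, aeval_def, eval₂_eq'] at hf
  have h := congrArg (fun q => Polynomial.coeff q (d p)) hf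
  simp only [← pow_mul, Finset.prod_pow_eq_pow_sum, Polynomial.finsetSum_coeff,
    Polynomial.algebraMap_eq, Polynomial.coeff_C_mul, Polynomial.coeff_X_pow,
    Polynomial.coeff_zero] at h
  rw [Finset.sum_eq_single (Finsupp.single p 1)] at h
  · rw [if_pos] at h
    · simpa using h
    · simp [Finsupp.single_apply]
  · intro u _ hu
    rw [if_neg, mul_zero]
    intro h'
    exact hu (weight_eq hpos hmin p u h'.symm)
  · intro h'
    simp [MvPolynomial.notMem_support_iff.1 h']

theorem coeff_two {k : Type*} [Field k] {n : ℕ} {d : Fin n → ℕ} (hpos : ∀ i, 0 < d i)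
    (hmin : MinimallyGenerates d) {f : MvPolynomial (Fin n) k} (hf : f ∈ toricIdeal k d)
    (p q : Fin n) (b : MvPolynomial (Fin n) k) :
    coeff (Finsupp.single p 1 + Finsupp.single q 1) (b * f) =
      constantCoeff b * coeff (Finsupp.single p 1 + Finsupp.single q 1) f := by
  induction b using MvPolynomial.induction_on with
  | C a => simp [coeff_C_mul]
  | add b c hb hc => simp [add_mul, hb, hc]
  | mul_X b l hb =>
    have hbf : b * f ∈ toricIdeal k d := Ideal.mul_mem_left _ _ hf
    rw [mul_right_comm, coeff_mul_X']
    simp only [map_mul, constantCoeff_X, mul_zero, zero_mul]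
    split_ifs with h
    · have : l = p ∨ l = q := by
        by_contra hc
        push Not at hc
        simp [Finsupp.single_apply, hc.1.symm, hc.2.symm] at h
      rcases this with rfl | rfl
      · rw [add_tsub_cancel_left]; exact coeff_single_zero hpos hmin hbf _
      · rw [add_tsub_cancel_right]; exact coeff_single_zero hpos hmin hbf _
    · rfl

theorem exists_ne_cast {k : Type*} [Field k] {n : ℕ} {d : Fin n → ℕ}
    (hgcd : Finset.univ.gcd d = 1) : ∃ j, (d j : k) ≠ 0 := by
  by_contra hc
  push Not at hc
  have h : ringChar k ∣ Finset.univ.gcd d := Finset.dvd_gcd fun j _ =>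
    (ringChar.spec k (d j)).1 (hc j)
  rw [hgcd, ← ringChar.spec] at h
  simp at h

/-- Toric derivation along `x_l ∂_l`. -/
noncomputable def dl (k : Type*) [Field k] {n : ℕ} (d : Fin n → ℕ) (l : Fin n)
    (f : MvPolynomial (Fin n) k) : Polynomial k := phiM k d (X l * pderiv l f)

theorem dl_sum {k : Type*} [Field k] {n m : ℕ} {d : Fin n → ℕ} (l : Fin n)
    (b g : Fin m → MvPolynomial (Fin n) k) (hg : ∀ i, g i ∈ toricIdeal k d) :
    dl k d l (∑ i, b i * g i) = ∑ i, phiM k d (b i) * dl k d l (g i) := by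
  simp only [dl, map_sum, Finset.mul_sum]
  refine Finset.sum_congr rfl fun i _ => ?_
  have := mem_toric.1 (hg i)
  simp only [Derivation.leibniz, smul_eq_mul, map_mul, map_add, this]
  ring

theorem syz {k : Type*} [Field k] {m : ℕ} {d : Fin (m+1) → ℕ}
    (hgcd : Finset.univ.gcd d = 1)
    (g : Fin m → MvPolynomial (Fin (m+1)) k) (hg : Ideal.span (Set.range g) = toricIdeal k d)
    (b : Fin m → MvPolynomial (Fin (m+1)) k) (hb : ∑ i, b i * g i = 0) (i : Fin m) :
    phiM k d (b i) = 0 := by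
  obtain ⟨j, hj⟩ := exists_ne_cast (k := k) hgcd
  have hgm : ∀ i, g i ∈ toricIdeal k d := fun i => hg ▸ Ideal.subset_span ⟨i, rfl⟩
  let J : Matrix (Fin m) (Fin m) (Polynomial k) := fun i l => dl k d (j.succAbove l) (g i)
  let F : Fin m → MvPolynomial (Fin (m+1)) k := fun l =>
    X (j.succAbove l) ^ d j - X j ^ d (j.succAbove l)
  have hF : ∀ l, ∃ c : Fin m → MvPolynomial (Fin (m+1)) k, ∑ i, c i * g i = F l := by
    intro l
    have : F l ∈ Ideal.span (Set.range g) := by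
      rw [hg, mem_toric]
      simp [F, phiM_X, ← pow_mul, mul_comm]
    exact Ideal.mem_span_range_iff_exists_fun.1 this
  choose c hc using hF
  have hprod : (Matrix.of fun l i => phiM k d (c l i)) * J =
      Matrix.diagonal fun l => (Polynomial.C (d j : k)) * Polynomial.X ^ (d (j.succAbove l) * d j) := by
    ext1 l l'
    rw [Matrix.mul_apply]
    simp only [Matrix.of_apply, J]
    rw [← dl_sum _ _ _ hgm, hc, Matrix.diagonal_apply]
    have hne : j ≠ j.succAbove l' := (Fin.succAbove_ne j l').symm
    simp only [F, dl, map_sub, Derivation.leibniz_pow, pderiv_X]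
    split_ifs with h
    · subst h
      have e1 : d (j.succAbove l) * d j = d (j.succAbove l) + d (j.succAbove l) * (d j - 1) := by
        have : d j ≠ 0 := by rintro h; simp [h] at hj
        obtain ⟨r, hr⟩ := Nat.exists_eq_succ_of_ne_zero this
        rw [hr]; simp; ring
      rw [e1]
      simp [hne, phiM_X, ← pow_mul, pow_add]
      ring
    · have : j.succAbove l ≠ j.succAbove l' := fun h' => h (Fin.succAbove_right_injective h')
      simp [hne, this]
  have hdet : J.det ≠ 0 := by
    intro h0
    have := congrArg Matrix.det hprod
    rw [Matrix.det_mul, h0, mul_zero, Matrix.det_diagonal] at this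
    refine Finset.prod_ne_zero_iff.2 (fun l _ => ?_) this.symm
    exact mul_ne_zero (Polynomial.C_ne_zero.2 hj) (pow_ne_zero _ Polynomial.X_ne_zero)
  have hv : Matrix.vecMul (fun i => phiM k d (b i)) J = 0 := by
    ext1 l
    simp only [Matrix.vecMul, dotProduct, J]
    rw [← dl_sum _ _ _ hgm, hb]
    simp [dl]
  exact congrFun (Matrix.eq_zero_of_vecMul_eq_zero hdet hv) i

theorem main_aux {k : Type*} [Field k] {m : ℕ} {d : Fin (m+1) → ℕ} (hpos : ∀ i, 0 < d i)
    (hgcd : Finset.univ.gcd d = 1) (hmin : MinimallyGenerates d)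
    (g : Fin m → MvPolynomial (Fin (m+1)) k) (hg : Ideal.span (Set.range g) = toricIdeal k d)
    (f a : Fin 3 → MvPolynomial (Fin (m+1)) k) (hf : ∀ s, f s ∈ toricIdeal k d)
    (ha : a 0 ∉ toricIdeal k d) (haf : ∑ s, a s * f s = 0) (p q : Fin 3 → Fin (m+1))
    (hco : ∀ s r, coeff (Finsupp.single (p r) 1 + Finsupp.single (q r) 1) (f s) =
      if s = r then 1 else 0) : False := by
  have hgm : ∀ i, g i ∈ toricIdeal k d := fun i => hg ▸ Ideal.subset_span ⟨i, rfl⟩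
  have hF : ∀ s, ∃ c : Fin m → MvPolynomial (Fin (m+1)) k, ∑ i, c i * g i = f s := fun s =>
    Ideal.mem_span_range_iff_exists_fun.1 (hg ▸ hf s)
  choose c hc using hF
  have h1 : ∀ i, phiM k d (∑ s, a s * c s i) = 0 := by
    refine syz hgcd g hg _ ?_
    rw [← haf]
    simp_rw [Finset.sum_mul, ← hc, Finset.mul_sum]
    rw [Finset.sum_comm]
    simp_rw [mul_assoc]
  let N : Matrix (Fin 3) (Fin 3) (Polynomial k) := fun s r =>
    ∑ i, phiM k d (c s i) * Polynomial.C (coeff (Finsupp.single (p r) 1 + Finsupp.single (q r) 1) (g i))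
  have h2 : Matrix.vecMul (fun s => phiM k d (a s)) N = 0 := by
    ext1 r
    simp only [Matrix.vecMul, dotProduct, N, Finset.mul_sum]
    rw [Finset.sum_comm]
    refine Finset.sum_eq_zero fun i _ => ?_
    simp_rw [← mul_assoc]
    rw [← Finset.sum_mul]
    have := h1 i
    simp only [map_sum, map_mul] at this
    rw [this, zero_mul]
  have h3 : N.det ≠ 0 := by
    intro h0
    have h4 : (Polynomial.evalRingHom (0 : k)).mapMatrix N = 1 := by
      ext s r
      rw [RingHom.mapMatrix_apply, Matrix.map_apply, Matrix.one_apply, ← hco, ← hc, coeff_sum]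
      simp only [N, map_sum, map_mul, Polynomial.coe_evalRingHom, Polynomial.eval_C,
        phiM_eval_zero hpos]
      exact Finset.sum_congr rfl fun i _ => (coeff_two hpos hmin (hgm i) _ _ _).symm
    have h5 := RingHom.map_det (Polynomial.evalRingHom (0 : k)) N
    rw [h4, h0] at h5
    simp at h5
  exact ha (congrFun (Matrix.eq_zero_of_vecMul_eq_zero h3 h2) 0)

theorem coeff_XX {k : Type*} [Field k] {n : ℕ} (a b : Fin n) (w : Fin n →₀ ℕ) :
    coeff w (X a * X b : MvPolynomial (Fin n) k) =
      if Finsupp.single a 1 + Finsupp.single b 1 = w then 1 else 0 := by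
  rw [X, X, monomial_mul, coeff_monomial, one_mul]

theorem coeff_XpX {k : Type*} [Field k] {n : ℕ} (a b : Fin n) (h : ℕ) (w : Fin n →₀ ℕ) :
    coeff w (X a ^ h * X b : MvPolynomial (Fin n) k) =
      if Finsupp.single a h + Finsupp.single b 1 = w then 1 else 0 := by
  rw [X_pow_eq_monomial, X, monomial_mul, coeff_monomial, one_mul]

/-- Let `A = {d₁,…,dₙ}` be positive integers with `n ≥ 4`,
`gcd(A) = 1`, minimally generating its numerical semigroup. If some four
elements of `A` form a generalized arithmetic sequence, then `I_A` is not a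
complete intersection. -/
theorem stmt11 (k : Type*) [Field k] (n : ℕ) (d : Fin n → ℕ)
    (hn : 4 ≤ n) (hpos : ∀ i, 0 < d i)
    (hgcd : Finset.univ.gcd d = 1) (hmin : MinimallyGenerates d)
    (hfour : ∃ (i₁ i₂ i₃ i₄ : Fin n) (h e : ℕ), 0 < h ∧ 0 < e ∧
      d i₂ = h * d i₁ + e ∧ d i₃ = d i₂ + e ∧ d i₄ = d i₃ + e) :
    ¬ IsCI k d := by
  rintro ⟨g, hg⟩
  obtain ⟨i₁, i₂, i₃, i₄, h, e, hh, he, e2, e3, e4⟩ := hfour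
  obtain ⟨m, rfl⟩ : ∃ m, n = m + 1 := ⟨n - 1, by omega⟩
  have hle : d i₁ ≤ h * d i₁ := Nat.le_mul_of_pos_left _ hh
  have n12 : i₁ ≠ i₂ := by rintro rfl; omega
  have n13 : i₁ ≠ i₃ := by rintro rfl; omega
  have n14 : i₁ ≠ i₄ := by rintro rfl; omega
  have n23 : i₂ ≠ i₃ := by rintro rfl; omega
  have n24 : i₂ ≠ i₄ := by rintro rfl; omega
  have n34 : i₃ ≠ i₄ := by rintro rfl; omega
  refine main_aux hpos hgcd hmin g hg
    ![X i₂ * X i₂ - X i₁ ^ h * X i₃, X i₂ * X i₃ - X i₁ ^ h * X i₄, X i₃ * X i₃ - X i₂ * X i₄]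
    ![X i₃, - X i₂, X i₁ ^ h] ?_ ?_ ?_ ![i₂, i₂, i₃] ![i₂, i₃, i₃] ?_
  · intro s
    rw [mem_toric]
    fin_cases s <;>
      simp only [Fin.zero_eta, Fin.mk_one, Fin.reduceFinMk, Matrix.cons_val, map_sub, map_mul,
        map_pow, phiM_X, ← pow_mul, ← pow_add, sub_eq_zero] <;>
      congr 1 <;> (try rw [mul_comm (d i₁)]) <;> omega
  · simp [mem_toric, phiM_X]
  · simp [Fin.sum_univ_three]
    ring
  · have A : ∀ a b c f : Fin (m+1), (Finsupp.single a 1 + Finsupp.single b 1 : Fin (m+1) →₀ ℕ) =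
        Finsupp.single c 1 + Finsupp.single f 1 → (a = c ∧ b = f) ∨ (a = f ∧ b = c) := by
      intro a b c f hab
      have ha := DFunLike.congr_fun hab a
      have hb := DFunLike.congr_fun hab b
      have hc := DFunLike.congr_fun hab c
      have hf := DFunLike.congr_fun hab f
      simp only [Finsupp.add_apply, Finsupp.single_apply] at ha hb hc hf
      grind
    have B : ∀ b c f : Fin (m+1), i₁ ≠ c → i₁ ≠ f →
        (Finsupp.single i₁ h + Finsupp.single b 1 : Fin (m+1) →₀ ℕ) ≠
        Finsupp.single c 1 + Finsupp.single f 1 := by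
      intro b c f hc hf hab
      have ha := DFunLike.congr_fun hab i₁
      simp only [Finsupp.add_apply, Finsupp.single_apply] at ha
      simp [hc.symm, hf.symm] at ha
      omega
    intro s r
    fin_cases s <;> fin_cases r <;>
      simp only [Fin.zero_eta, Fin.mk_one, Fin.reduceFinMk, Matrix.cons_val, coeff_sub, coeff_XX,
        coeff_XpX, B _ _ _ n12 n12, B _ _ _ n12 n13, B _ _ _ n13 n13, if_false] <;>
      grind
end

section
/- Let A = {d_1, …, d_n} be a set of positive integers with n ≥ 5 such that {d_1, …, d_{n−1}} is a generalized arithmetic sequence, gcd(d_1, …, d_n) = 1, and A minimally generates the numerical semigroup ℕd_1 + … + ℕd_n. Then the toric ideal I_A is not a complete intersection. -/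
open MvPolynomial

/-- weighted degree of a monomial -/
def wdeg {n : ℕ} (d : Fin n → ℕ) (u : Fin n →₀ ℕ) : ℕ := ∑ i, u i * d i

/-- a monomial sharing no variable with another one of the same degree -/
def Isol {n : ℕ} (d : Fin n → ℕ) (u : Fin n →₀ ℕ) : Prop :=
  ∀ i w, u = Finsupp.single i 1 + w → ∀ v, wdeg d v = wdeg d w → v = w

lemma wdeg_add {n : ℕ} (d : Fin n → ℕ) (u v : Fin n →₀ ℕ) :
    wdeg d (u + v) = wdeg d u + wdeg d v := by
  simp [wdeg, add_mul, Finset.sum_add_distrib]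

lemma wdeg_single {n : ℕ} (d : Fin n → ℕ) (i : Fin n) (p : ℕ) :
    wdeg d (Finsupp.single i p) = p * d i := by
  simp only [wdeg]
  rw [Finset.sum_eq_single i]
  · simp
  · intro b _ hb
    simp [Finsupp.single_apply, hb.symm]
  · simp

lemma wdeg_eq_zero {n : ℕ} {d : Fin n → ℕ} (hpos : ∀ i, 0 < d i) {u : Fin n →₀ ℕ}
    (h : wdeg d u = 0) : u = 0 := by
  ext i
  simp only [wdeg, Finset.sum_eq_zero_iff, Finset.mem_univ, true_imp_iff, mul_eq_zero] at h
  rcases h i with h | h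
  · simpa using h
  · exact absurd h (hpos i).ne'

lemma aeval_mono (k : Type*) [Field k] {n : ℕ} (d : Fin n → ℕ) (u : Fin n →₀ ℕ) (c : k) :
    aeval (fun i : Fin n => (Polynomial.X : Polynomial k) ^ d i) (monomial u c) =
      Polynomial.monomial (wdeg d u) c := by
  rw [aeval_monomial, ← Polynomial.C_mul_X_pow_eq_monomial]
  congr 1
  rw [Finsupp.prod_fintype _ _ (by simp), wdeg, ← Finset.prod_pow_eq_pow_sum]
  refine Finset.prod_congr rfl fun i _ => ?_
  rw [← pow_mul, mul_comm]

lemma binom_mem (k : Type*) [Field k] {n : ℕ} (d : Fin n → ℕ) (u v : Fin n →₀ ℕ)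
    (h : wdeg d u = wdeg d v) :
    (monomial u (1 : k) - monomial v 1) ∈ toricIdeal k d := by
  rw [toricIdeal, RingHom.mem_ker]
  change aeval _ _ = _
  rw [map_sub, aeval_mono, aeval_mono, h, sub_self]

lemma coeff_eq_zero_of_unique (k : Type*) [Field k] {n : ℕ} (d : Fin n → ℕ) (w : Fin n →₀ ℕ)
    (hw : ∀ v, wdeg d v = wdeg d w → v = w) (f : MvPolynomial (Fin n) k)
    (hf : f ∈ toricIdeal k d) : coeff w f = 0 := by
  rw [toricIdeal, RingHom.mem_ker] at hf
  change aeval _ f = _ at hf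
  rw [f.as_sum, map_sum] at hf
  simp only [aeval_mono] at hf
  have h2 := congrArg (fun q => Polynomial.coeff q (wdeg d w)) hf
  simp only [Polynomial.finsetSum_coeff, Polynomial.coeff_monomial, Polynomial.coeff_zero] at h2
  by_cases hs : w ∈ f.support
  · rw [Finset.sum_eq_single w] at h2
    · simpa using h2
    · intro b _ hb
      rw [if_neg]
      intro h
      exact hb (hw b h)
    · intro h
      exact absurd hs h
  · simpa using hs

lemma coeff_mul_isol (k : Type*) [Field k] {n : ℕ} (d : Fin n → ℕ) (u : Fin n →₀ ℕ)
    (hu : Isol d u) (c f : MvPolynomial (Fin n) k)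
    (hf : f ∈ toricIdeal k d) : coeff u (c * f) = constantCoeff c * coeff u f := by
  classical
  rw [coeff_mul, Finset.sum_eq_single (0, u)]
  · rfl
  · rintro ⟨a, b⟩ hab hne
    rw [Finset.HasAntidiagonal.mem_antidiagonal] at hab
    simp only at hab ⊢
    have ha : a ≠ 0 := by
      rintro rfl
      apply hne
      simp at hab
      rw [hab]
    obtain ⟨i, hi⟩ := Finsupp.ne_iff.mp ha
    simp only [Finsupp.coe_zero, Pi.zero_apply] at hi
    obtain ⟨a', rfl⟩ : ∃ a', a = Finsupp.single i 1 + a' :=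
      le_iff_exists_add.mp (Finsupp.single_le_iff.mpr (Nat.pos_of_ne_zero hi))
    have h := hu i (a' + b) (by rw [← hab, add_assoc])
    rw [coeff_eq_zero_of_unique k d b _ f hf, mul_zero]
    intro v hv
    have := h (a' + v) (by rw [wdeg_add, wdeg_add, hv])
    exact add_left_cancel this
  · intro h
    simp at h

lemma key_s12 (k : Type*) [Field k] {n : ℕ} (d : Fin n → ℕ) (U : Finset (Fin n →₀ ℕ))
    (hU : ∀ u ∈ U, Isol d u) (hcard : n - 1 < U.card) (hCI : IsCI k d) :
    ∃ l : (Fin n →₀ ℕ) → k, (∃ u, l u ≠ 0) ∧ (∀ u, u ∉ U → l u = 0) ∧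
      ∀ u v, wdeg d u = wdeg d v → l u = l v := by
  classical
  obtain ⟨g, hg⟩ := hCI
  let T : (U → k) →ₗ[k] (Fin (n - 1) → k) :=
    { toFun := fun l t => ∑ u : U, l u * coeff u.1 (g t)
      map_add' := by
        intro a b
        ext t
        simp [add_mul, Finset.sum_add_distrib]
      map_smul' := by
        intro a b
        ext t
        simp [Finset.mul_sum, mul_assoc] }
  have hk : LinearMap.ker T ≠ ⊥ := by
    apply LinearMap.ker_ne_bot_of_finrank_lt
    simpa using hcard
  obtain ⟨l, hl, hl0⟩ := (Submodule.ne_bot_iff _).mp hk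
  rw [LinearMap.mem_ker] at hl
  have hlt : ∀ t, ∑ u : U, l u * coeff u.1 (g t) = 0 := fun t => congrFun hl t
  have hgI : ∀ t, g t ∈ toricIdeal k d := fun t => hg ▸ Ideal.subset_span ⟨t, rfl⟩
  have hvan : ∀ f ∈ toricIdeal k d, ∑ u : U, l u * coeff u.1 f = 0 := by
    intro f hf
    rw [← hg, Ideal.mem_span_range_iff_exists_fun] at hf
    obtain ⟨c, rfl⟩ := hf
    simp only [coeff_sum, Finset.mul_sum]
    rw [Finset.sum_comm]
    apply Finset.sum_eq_zero
    intro t _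
    have : ∀ u : U, l u * coeff u.1 (c t * g t) =
        constantCoeff (c t) * (l u * coeff u.1 (g t)) := by
      intro u
      rw [coeff_mul_isol k d u.1 (hU _ u.2) _ _ (hgI t)]
      ring
    simp only [this]
    rw [← Finset.mul_sum, hlt, mul_zero]
  have hmon : ∀ v, ∑ u : U, l u * coeff u.1 (monomial v (1 : k)) =
      if h : v ∈ U then l ⟨v, h⟩ else 0 := by
    intro v
    split_ifs with h
    · rw [Finset.sum_eq_single ⟨v, h⟩]
      · simp
      · intro b _ hb
        rw [coeff_monomial, if_neg, mul_zero]
        intro h'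
        exact hb (Subtype.ext h'.symm)
      · simp
    · apply Finset.sum_eq_zero
      intro b _
      rw [coeff_monomial, if_neg, mul_zero]
      intro h'
      exact h (h' ▸ b.2)
  refine ⟨fun v => if h : v ∈ U then l ⟨v, h⟩ else 0, ?_, ?_, ?_⟩
  · obtain ⟨u, hu⟩ := Function.ne_iff.mp hl0
    exact ⟨u.1, by simpa using hu⟩
  · intro u hu
    simp [hu]
  · intro u v huv
    have := hvan _ (binom_mem k d u v huv)
    simp only [coeff_sub, mul_sub, Finset.sum_sub_distrib] at this
    rw [hmon, hmon] at this
    exact sub_eq_zero.mp this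

lemma uniq_single {n : ℕ} {d : Fin n → ℕ} (hpos : ∀ i, 0 < d i) (hmin : MinimallyGenerates d)
    (b : Fin n) (v : Fin n →₀ ℕ) (h : wdeg d v = d b) : v = Finsupp.single b 1 := by
  by_cases hb : v b = 0
  · exact absurd ⟨v, hb, h.symm⟩ (hmin b)
  · obtain ⟨w, rfl⟩ : ∃ w, v = Finsupp.single b 1 + w :=
      le_iff_exists_add.mp (Finsupp.single_le_iff.mpr (Nat.pos_of_ne_zero hb))
    rw [wdeg_add, wdeg_single] at h
    rw [wdeg_eq_zero hpos (u := w) (by omega), add_zero]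

lemma isol_quad {n : ℕ} {d : Fin n → ℕ} (hpos : ∀ i, 0 < d i) (hmin : MinimallyGenerates d)
    (a b : Fin n) : Isol d (Finsupp.single a 1 + Finsupp.single b 1) := by
  intro i w hw v hv
  have hi : i = a ∨ i = b := by
    by_contra hc
    push Not at hc
    have := DFunLike.congr_fun hw i
    simp [hc.1.symm, hc.2.symm] at this
    omega
  rcases hi with rfl | rfl
  · have := add_left_cancel hw
    subst this
    exact uniq_single hpos hmin _ _ (by rw [hv, wdeg_single, one_mul])
  · rw [add_comm] at hw
    have := add_left_cancel hw
    subst this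
    exact uniq_single hpos hmin _ _ (by rw [hv, wdeg_single, one_mul])

lemma exists_pure {n : ℕ} {d : Fin n → ℕ} (hpos : ∀ i, 0 < d i) (z y : Fin n) (hzy : y ≠ z) :
    ∃ p, 0 < p ∧ Isol d (Finsupp.single z p) ∧
      ∃ v : Fin n →₀ ℕ, v z = 0 ∧ wdeg d v = wdeg d (Finsupp.single z p) := by
  classical
  have hex : ∃ p, 0 < p ∧ ∃ v : Fin n →₀ ℕ, v z = 0 ∧ wdeg d v = p * d z :=
    ⟨d y, hpos y, Finsupp.single y (d z), by simp [Finsupp.single_apply, hzy],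
      by rw [wdeg_single, mul_comm]⟩
  obtain ⟨h0, v, hv, hvd⟩ := Nat.find_spec hex
  have hm := fun {m} => Nat.find_min hex (m := m)
  generalize Nat.find hex = p at *
  refine ⟨p, h0, ?_, v, hv, by rw [hvd, wdeg_single]⟩
  intro i w hw v hv
  have hi : i = z := by
    by_contra hc
    have := DFunLike.congr_fun hw i
    simp [Ne.symm hc] at this
    omega
  subst hi
  obtain ⟨q, rfl⟩ : ∃ q, p = q + 1 := ⟨p - 1, by omega⟩
  rw [add_comm q 1, Finsupp.single_add] at hw
  have := add_left_cancel hw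
  subst this
  have hsplit : Finsupp.single i (v i) + v.erase i = v := Finsupp.single_add_erase i v
  rw [← hsplit, wdeg_add, wdeg_single, wdeg_single] at hv
  have hle : v i ≤ q := by
    by_contra hc
    have : q * d i < v i * d i := Nat.mul_lt_mul_of_pos_right (by omega) (hpos i)
    omega
  obtain ⟨r, hr⟩ := Nat.exists_eq_add_of_le hle
  have hdeg : wdeg d (v.erase i) = r * d i := by
    rw [hr, add_mul] at hv
    omega
  rcases Nat.eq_zero_or_pos r with h | h
  · subst h
    rw [wdeg_eq_zero hpos (u := v.erase i) (by simpa using hdeg), add_zero] at hsplit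
    rw [← hsplit, hr, add_zero]
  · exact absurd ⟨h, v.erase i, by simp, hdeg⟩ (hm (by omega))

/-- two good pure powers among three variables -/
lemma exists_pair {n : ℕ} {d : Fin n → ℕ} (hpos : ∀ i, 0 < d i) (z : Fin 3 → Fin n)
    (hz : Function.Injective z) :
    ∃ a b : Fin 3, ∃ p q : ℕ, a ≠ b ∧ 0 < p ∧ 0 < q ∧ Isol d (Finsupp.single (z a) p) ∧
      Isol d (Finsupp.single (z b) q) ∧
      (∃ v, wdeg d v = wdeg d (Finsupp.single (z a) p) ∧ v ≠ Finsupp.single (z a) p ∧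
        v ≠ Finsupp.single (z b) q) ∧
      (∃ v, wdeg d v = wdeg d (Finsupp.single (z b) q) ∧ v ≠ Finsupp.single (z a) p ∧
        v ≠ Finsupp.single (z b) q) := by
  have H : ∀ a : Fin 3, ∃ p, 0 < p ∧ Isol d (Finsupp.single (z a) p) ∧
      ∃ v : Fin n →₀ ℕ, v (z a) = 0 ∧ wdeg d v = wdeg d (Finsupp.single (z a) p) := by
    intro a
    refine exists_pure hpos (z a) (z (a + 1)) ?_
    intro h
    have := hz h
    clear h
    revert this
    revert a
    decide
  choose p hp hI v hv hvd using H
  by_cases hd : ∃ a b, wdeg d (Finsupp.single (z a) (p a)) ≠ wdeg d (Finsupp.single (z b) (p b))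
  · obtain ⟨a, b, hab⟩ := hd
    refine ⟨a, b, p a, p b, ?_, hp a, hp b, hI a, hI b, ⟨v a, hvd a, ?_, ?_⟩,
      ⟨v b, hvd b, ?_, ?_⟩⟩
    · rintro rfl
      exact hab rfl
    · intro h
      have h1 := hv a
      rw [h, Finsupp.single_eq_same] at h1
      exact (hp a).ne' h1
    · intro h
      exact hab (by rw [← hvd a, h])
    · intro h
      exact hab (by rw [← hvd b, h])
    · intro h
      have h1 := hv b
      rw [h, Finsupp.single_eq_same] at h1
      exact (hp b).ne' h1
  · push Not at hd
    have hne : ∀ a b : Fin 3, a ≠ b →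
        Finsupp.single (z a) (p a) ≠ Finsupp.single (z b) (p b) := by
      intro a b hab h
      rw [Finsupp.single_eq_single_iff] at h
      rcases h with h | h
      · exact hab (hz h.1)
      · exact (hp a).ne' h.1
    exact ⟨0, 1, p 0, p 1, by decide, hp 0, hp 1, hI 0, hI 1,
      ⟨Finsupp.single (z 2) (p 2), hd _ _, hne _ _ (by decide), hne _ _ (by decide)⟩,
      ⟨Finsupp.single (z 2) (p 2), hd _ _, hne _ _ (by decide), hne _ _ (by decide)⟩⟩

/-- Let `A = {d₁,…,dₙ}` be positive integers with `n ≥ 5` such that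
`{d₁,…,d_{n−1}}` is a generalized arithmetic sequence, `gcd(A) = 1`, and `A`
minimally generates its numerical semigroup. Then `I_A` is not a complete
intersection. -/
theorem stmt12 (k : Type*) [Field k] (n : ℕ) (d : Fin n → ℕ)
    (hn : 5 ≤ n) (hpos : ∀ i, 0 < d i)
    (hga : IsGenArith (fun j : Fin (n - 1) => d (j.castLE (by omega))))
    (hgcd : Finset.univ.gcd d = 1) (hmin : MinimallyGenerates d) :
    ¬ IsCI k d := by
  classical
  intro hCI
  obtain ⟨h, e, hh, he, hd⟩ := hga
  obtain ⟨m, rfl⟩ : ∃ m, n = m + 5 := ⟨n - 5, by omega⟩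
  have hd' : ∀ i (hi : i < m + 4), 0 < i →
      d ⟨i, by omega⟩ = h * d ⟨0, by omega⟩ + i * e := fun i hi h0 => hd ⟨i, hi⟩ h0
  let z : Fin 3 → Fin (m + 5) := ![⟨0, by omega⟩, ⟨m + 3, by omega⟩, ⟨m + 4, by omega⟩]
  have hz : Function.Injective z := by
    intro a b hab
    fin_cases a <;> fin_cases b <;> simp [z, Fin.ext_iff] at hab ⊢
  have hz12 : ∀ a, (z a : ℕ) ≠ 1 ∧ (z a : ℕ) ≠ 2 := by
    intro a
    fin_cases a <;> simp [z]
  obtain ⟨a, b, p, q, hab, hp, hq, hIa, hIb, ⟨va, hva, hvaa, hvab⟩, ⟨vb, hvb, hvba, hvbb⟩⟩ :=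
    exists_pair hpos z hz
  let Q : Fin (m + 2) → (Fin (m + 5) →₀ ℕ) := fun j =>
    Finsupp.single ⟨1, by omega⟩ 1 + Finsupp.single ⟨j + 1, by omega⟩ 1
  let R : Fin (m + 5) →₀ ℕ := Finsupp.single ⟨2, by omega⟩ 1 + Finsupp.single ⟨2, by omega⟩ 1
  let Pa := Finsupp.single (z a) p
  let Pb := Finsupp.single (z b) q
  have hQinj : Function.Injective Q := by
    intro i j hij
    have := add_left_cancel hij
    rw [Finsupp.single_eq_single_iff] at this
    simp [Fin.ext_iff] at this
    exact Fin.ext this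
  have ev1 : ∀ a p, (Finsupp.single (z a) p) ⟨1, by omega⟩ = 0 := by
    intro a p
    rw [Finsupp.single_apply, if_neg]
    intro h
    exact (hz12 a).1 (by rw [h])
  have ev2 : ∀ a p, (Finsupp.single (z a) p) ⟨2, by omega⟩ = 0 := by
    intro a p
    rw [Finsupp.single_apply, if_neg]
    intro h
    exact (hz12 a).2 (by rw [h])
  have hQ1 : ∀ j, Q j ⟨1, by omega⟩ ≠ 0 := by
    intro j
    simp [Q]
  have hR1 : R ⟨1, by omega⟩ = 0 := by
    simp [R, Finsupp.single_apply]
  have hR2 : R ⟨2, by omega⟩ ≠ 0 := by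
    simp [R]
  let U0 : Finset (Fin (m + 5) →₀ ℕ) := Finset.univ.image Q
  let U : Finset (Fin (m + 5) →₀ ℕ) := insert Pa (insert Pb (insert R U0))
  have hRU : R ∉ U0 := by
    simp only [U0, Finset.mem_image, Finset.mem_univ, true_and, not_exists]
    intro j hj
    exact hQ1 j (by rw [hj, hR1])
  have hPU : ∀ a p, Finsupp.single (z a) p ∉ insert R U0 := by
    intro a p
    simp only [U0, Finset.mem_insert, Finset.mem_image, Finset.mem_univ, true_and, not_or,
      not_exists]
    refine ⟨fun h => hR2 (by rw [← h, ev2]), fun j hj => hQ1 j (by rw [hj, ev1])⟩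
  have hPab : Pa ≠ Pb := by
    intro h
    rw [Finsupp.single_eq_single_iff] at h
    rcases h with h | h
    · exact hab (hz h.1)
    · omega
  have hc : U.card = m + 5 := by
    rw [Finset.card_insert_of_notMem, Finset.card_insert_of_notMem (hPU b q),
      Finset.card_insert_of_notMem hRU, Finset.card_image_of_injective _ hQinj]
    · simp
    · rw [Finset.mem_insert]
      exact fun h => h.elim hPab (hPU a p)
  have hUmem : ∀ u, u ∈ U ↔ u = Pa ∨ u = Pb ∨ u = R ∨ ∃ j, Q j = u := by
    intro u
    simp [U, U0]
  have hUI : ∀ u ∈ U, Isol d u := by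
    intro u hu
    rcases (hUmem u).mp hu with rfl | rfl | rfl | ⟨j, rfl⟩
    · exact hIa
    · exact hIb
    · exact isol_quad hpos hmin _ _
    · exact isol_quad hpos hmin _ _
  obtain ⟨l, ⟨u, hu⟩, hl0, hl⟩ := key_s12 k d U hUI (by omega) hCI
  have lQ : ∀ j, l (Q j) = 0 := by
    intro j
    let V : Fin (m + 5) →₀ ℕ :=
      Finsupp.single ⟨0, by omega⟩ h + Finsupp.single ⟨j + 2, by omega⟩ 1
    have V0 : V ⟨0, by omega⟩ ≠ 0 := by
      simp [V]
      omega
    have Vj : V ⟨j + 2, by omega⟩ ≠ 0 := by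
      simp [V]
    rw [hl (Q j) V]
    · apply hl0
      have hpure : ∀ a p, V ≠ Finsupp.single (z a) p := by
        intro a p hV
        rw [hV, Finsupp.single_apply] at V0 Vj
        have h1 : z a = ⟨0, by omega⟩ := by
          by_contra hc
          exact V0 (if_neg hc)
        have h2 : z a = ⟨j + 2, by omega⟩ := by
          by_contra hc
          exact Vj (if_neg hc)
        rw [h1] at h2
        have h3 := congrArg Fin.val h2
        change 0 = (j : ℕ) + 2 at h3
        omega
      rw [hUmem]
      rintro (hV | hV | hV | ⟨i, hV⟩)
      · exact hpure _ _ hV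
      · exact hpure _ _ hV
      · rw [hV] at V0
        simp [R, Finsupp.single_apply] at V0
      · rw [← hV] at V0
        simp [Q, Finsupp.single_apply] at V0
    · simp only [Q, V, wdeg_add, wdeg_single]
      rw [hd' 1 (by omega) (by omega), hd' (j + 1) (by omega) (by omega),
        hd' (j + 2) (by omega) (by omega)]
      ring
  have lR : l R = 0 := by
    let V : Fin (m + 5) →₀ ℕ :=
      Finsupp.single ⟨1, by omega⟩ 1 + Finsupp.single ⟨3, by omega⟩ 1
    rw [hl R V]
    · by_cases hV : V ∈ U
      · rcases (hUmem V).mp hV with hV | hV | hV | ⟨j, hV⟩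
        · have := ev1 a p
          change Pa _ = 0 at this
          rw [← hV] at this
          simp [V] at this
        · have := ev1 b q
          change Pb _ = 0 at this
          rw [← hV] at this
          simp [V] at this
        · rw [← hV] at hR1
          simp [V] at hR1
        · rw [← hV, lQ]
      · exact hl0 _ hV
    · simp only [R, V, wdeg_add, wdeg_single]
      rw [hd' 1 (by omega) (by omega), hd' 2 (by omega) (by omega),
        hd' 3 (by omega) (by omega)]
      ring
  have lother : ∀ v, v ≠ Pa → v ≠ Pb → l v = 0 := by
    intro v h1 h2
    by_cases hv : v ∈ U
    · rcases (hUmem v).mp hv with hv | hv | hv | ⟨j, hv⟩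
      · exact absurd hv h1
      · exact absurd hv h2
      · rw [hv, lR]
      · rw [← hv, lQ]
    · exact hl0 _ hv
  apply hu
  by_cases h1 : u = Pa
  · rw [h1, hl Pa va hva.symm, lother va hvaa hvab]
  by_cases h2 : u = Pb
  · rw [h2, hl Pb vb hvb.symm, lother vb hvba hvbb]
  exact lother u h1 h2
end
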